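/- arXiv:2308.01870 — 8 statements merged into one kernel-verified Lean document; each statement's English description precedes it below -/
import Mathlib

section
/- Let ω be a modulus of continuity on [0, δ0] such that t ↦ ω(t)/t is integrable on [0, δ0], and set W_ω(t) = ∫_0^t ω(s)/s ds for t ∈ [0, δ0]. Then W_ω is itself a modulus of continuity on [0, δ0]: W_ω(0) = 0, W_ω is continuous on [0, δ0], W_ω is almost increasing on [0, δ0], and t ↦ W_ω(t)/t is almost decreasing on (0, δ0]. -/
/-- A modulus of continuity on `[0, δ0]`: vanishes at `0`, is continuous and
nonnegative on `[0, δ0]`, is almost increasing on `[0, δ0]`, and `t ↦ ω t / t`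
is almost decreasing on `(0, δ0]`. -/
def IsModulusOfContinuity (δ0 : ℝ) (ω : ℝ → ℝ) : Prop :=
  ω 0 = 0 ∧
  ContinuousOn ω (Set.Icc 0 δ0) ∧
  (∀ t ∈ Set.Icc 0 δ0, 0 ≤ ω t) ∧
  (∃ C : ℝ, 1 ≤ C ∧ ∀ t s : ℝ, 0 ≤ t → t ≤ s → s ≤ δ0 → ω t ≤ C * ω s) ∧
  (∃ C : ℝ, 1 ≤ C ∧ ∀ s t : ℝ, 0 < s → s ≤ t → t ≤ δ0 → ω t / t ≤ C * (ω s / s))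

/-- The averaged modulus  is itself a modulus of continuity on . -/
theorem W_isModulusOfContinuity (δ0 : ℝ) (hδ0 : 0 < δ0) (ω : ℝ → ℝ)
    (hω : IsModulusOfContinuity δ0 ω)
    (hint : MeasureTheory.IntegrableOn (fun s => ω s / s) (Set.Ioc 0 δ0))
    (W : ℝ → ℝ) (hW : ∀ t, W t = ∫ s in (0:ℝ)..t, ω s / s) :
    IsModulusOfContinuity δ0 W := by
  obtain ⟨-, -, h_nonneg, -, C, hC, h_dec⟩ := hω
  obtain rfl : W = fun t => ∫ s in (0:ℝ)..t, ω s / s := funext hW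
  have h_int : ∀ a b : ℝ, 0 ≤ a → a ≤ b → b ≤ δ0 →
      IntervalIntegrable (fun s => ω s / s) MeasureTheory.volume a b := fun a b ha hab hb =>
    (intervalIntegrable_iff_integrableOn_Ioc_of_le hab).2
      (hint.mono_set (Set.Ioc_subset_Ioc ha hb))
  have h_integral_nonneg : ∀ a b : ℝ, 0 ≤ a → a ≤ b → b ≤ δ0 →
      0 ≤ ∫ s in a..b, ω s / s := fun a b ha hab hb =>
    intervalIntegral.integral_nonneg hab fun u hu =>
      div_nonneg (h_nonneg u ⟨ha.trans hu.1, hu.2.trans hb⟩) (ha.trans hu.1)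
  refine ⟨intervalIntegral.integral_same, ?_,
    fun t ht => h_integral_nonneg 0 t le_rfl ht.1 ht.2, ⟨1, le_rfl, ?_⟩, C, hC, ?_⟩
  · have h := intervalIntegral.continuousOn_primitive_interval
      (f := fun s => ω s / s) (a := 0) (b := δ0) (μ := MeasureTheory.volume)
      (by rwa [Set.uIcc_of_le hδ0.le, integrableOn_Icc_iff_integrableOn_Ioc])
    rwa [Set.uIcc_of_le hδ0.le] at h
  · intro t s ht hts hs
    have h_add := intervalIntegral.integral_add_adjacent_intervals
      (h_int 0 t le_rfl ht (hts.trans hs)) (h_int t s ht hts hs)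
    have h_tail := h_integral_nonneg t s ht hts hs
    simp only [one_mul]
    linarith
  · intro s t hs hst ht
    have ht0 : 0 < t := hs.trans_le hst
    have h_one : 1 ≤ t / s := (one_le_div hs).2 hst
    have h_scale : t / s * s = t := div_mul_cancel₀ t hs.ne'
    have h_subst : ∫ u in (0:ℝ)..s, ω (t / s * u) / (t / s * u) =
        (t / s)⁻¹ * ∫ r in (0:ℝ)..t, ω r / r := by
      have h := intervalIntegral.integral_comp_mul_left (a := 0) (b := s)
        (fun r => ω r / r) (div_pos ht0 hs).ne'
      rwa [mul_zero, h_scale, smul_eq_mul] at h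
    have h_comp : IntervalIntegrable (fun u => ω (t / s * u) / (t / s * u))
        MeasureTheory.volume 0 s := by
      have h := (h_int 0 t le_rfl ht0.le ht).comp_mul_left (c := t / s)
      rwa [zero_div, div_div_cancel₀ ht0.ne'] at h
    have h_le : ∫ u in (0:ℝ)..s, ω (t / s * u) / (t / s * u) ≤
        ∫ u in (0:ℝ)..s, C * (ω u / u) := by
      refine intervalIntegral.integral_mono_on_of_le_Ioo hs.le h_comp
        ((h_int 0 s le_rfl hs.le (hst.trans ht)).const_mul C) fun u hu => ?_
      refine h_dec u _ hu.1 (le_mul_of_one_le_left hu.1.le h_one) ?_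
      calc t / s * u ≤ t / s * s := by gcongr; exact hu.2.le
        _ ≤ δ0 := h_scale.trans_le ht
    rw [h_subst, intervalIntegral.integral_const_mul] at h_le
    calc (∫ r in (0:ℝ)..t, ω r / r) / t = (t / s)⁻¹ * (∫ r in (0:ℝ)..t, ω r / r) / s := by
          field_simp
      _ ≤ C * (∫ r in (0:ℝ)..s, ω r / r) / s := by gcongr
      _ = C * ((∫ r in (0:ℝ)..s, ω r / r) / s) := mul_div_assoc _ _ _
end

section
/- Let ω be a modulus of continuity on [0, δ0] which is positive on (0, δ0]. Then the Matuszewska–Orlicz lower index satisfies m(ω) = sup{ γ > 0 : t ↦ ω(t)/t^γ is almost increasing on (0, δ0] }. -/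
open Filter Topology

/-- The Matuszewska--Orlicz lower index
`m(ω) = sup_{0<t<1} log(limsup_{ε→0+} ω(εt)/ω(ε)) / log t`. -/
noncomputable def lowerIndex (ω : ℝ → ℝ) : ℝ :=
  sSup { r : ℝ | ∃ t : ℝ, 0 < t ∧ t < 1 ∧
    r = Real.log (Filter.limsup (fun ε => ω (ε * t) / ω ε) (nhdsWithin 0 (Set.Ioi 0)))
          / Real.log t }

/-- The Matuszewska--Orlicz upper index
`M(ω) = sup_{t>1} log(limsup_{ε→0+} ω(εt)/ω(ε)) / log t`. -/
noncomputable def upperIndex (ω : ℝ → ℝ) : ℝ :=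
  sSup { r : ℝ | ∃ t : ℝ, 1 < t ∧
    r = Real.log (Filter.limsup (fun ε => ω (ε * t) / ω ε) (nhdsWithin 0 (Set.Ioi 0)))
          / Real.log t }

/-- If `ω` is almost increasing, then `ω t / t ^ γ` at comparable points is comparable. -/
lemma div_rpow_le_of_mul_le {δ C γ a y z : ℝ} {ω : ℝ → ℝ}
    (hinc : ∀ t s : ℝ, 0 ≤ t → t ≤ s → s ≤ δ → ω t ≤ C * ω s)
    (hpos : ∀ t : ℝ, 0 < t → t ≤ δ → 0 < ω t) (hγ : 0 < γ)
    (ha : 0 < a) (hz : 0 < z) (hzy : z ≤ y) (hy : y ≤ δ) (haz : a * y ≤ z) :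
    ω z / z ^ γ ≤ C * (a ^ γ)⁻¹ * (ω y / y ^ γ) := by
  have hy0 : 0 < y := hz.trans_le hzy
  have h1 : (a * y) ^ γ ≤ z ^ γ := Real.rpow_le_rpow (by positivity) haz hγ.le
  rw [Real.mul_rpow ha.le hy0.le] at h1
  have h2 := hinc z y hz.le hzy hy
  have h3 := hpos z hz (hzy.trans hy)
  have h4 : 0 < a ^ γ := Real.rpow_pos_of_pos ha γ
  have h5 : 0 < y ^ γ := Real.rpow_pos_of_pos hy0 γ
  calc ω z / z ^ γ ≤ (C * ω y) / (a ^ γ * y ^ γ) := by gcongr; exact h3.le.trans h2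
    _ = C * (a ^ γ)⁻¹ * (ω y / y ^ γ) := by field_simp

/-- A one-step decay estimate near `0` makes `ω t / t ^ γ` almost increasing. -/
lemma exists_almost_increasing_of_step {δ ε₀ C γ t : ℝ} {ω : ℝ → ℝ}
    (hC : 1 ≤ C) (hinc : ∀ t s : ℝ, 0 ≤ t → t ≤ s → s ≤ δ → ω t ≤ C * ω s)
    (hpos : ∀ t : ℝ, 0 < t → t ≤ δ → 0 < ω t) (hγ : 0 < γ)
    (hε₀ : 0 < ε₀) (hε₀δ : ε₀ ≤ δ) (ht : 0 < t) (ht1 : t < 1)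
    (hstep : ∀ ε : ℝ, 0 < ε → ε ≤ ε₀ → ω (ε * t) ≤ t ^ γ * ω ε) :
    ∃ C : ℝ, 1 ≤ C ∧
      ∀ t s : ℝ, 0 < t → t ≤ s → s ≤ δ → ω t / t ^ γ ≤ C * (ω s / s ^ γ) := by
  have hδ : 0 < δ := hε₀.trans_le hε₀δ
  have hiter : ∀ n : ℕ, ∀ z : ℝ, 0 < z → z ≤ ε₀ →
      ω (z * t ^ n) / (z * t ^ n) ^ γ ≤ ω z / z ^ γ := by
    intro n
    induction n with
    | zero => intro z _ _; simp
    | succ n ih =>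
      intro z hz hz0
      have hp : 0 < t ^ n := pow_pos ht n
      have hw : 0 < z * t ^ n := by positivity
      have hle : z * t ^ n ≤ ε₀ :=
        (mul_le_of_le_one_right hz.le (pow_le_one₀ ht.le ht1.le)).trans hz0
      refine le_trans ?_ (ih z hz hz0)
      have h := hstep _ hw hle
      have h4 : 0 < t ^ γ := Real.rpow_pos_of_pos ht γ
      have h5 : 0 < (z * t ^ n) ^ γ := Real.rpow_pos_of_pos hw γ
      rw [pow_succ, ← mul_assoc, Real.mul_rpow hw.le ht.le, div_le_div_iff₀ (by positivity) h5]
      nlinarith [mul_le_mul_of_nonneg_right h h5.le]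
  have hone : ∀ a : ℝ, 0 < a → a ≤ 1 → 1 ≤ C * (a ^ γ)⁻¹ := fun a ha ha1 =>
    one_le_mul_of_one_le_of_one_le hC
      ((one_le_inv₀ (Real.rpow_pos_of_pos ha γ)).2 (Real.rpow_le_one ha.le ha1 hγ.le))
  have hsmall : ∀ x y : ℝ, 0 < x → x ≤ y → y ≤ ε₀ →
      ω x / x ^ γ ≤ C * (t ^ γ)⁻¹ * (ω y / y ^ γ) := by
    intro x y hx hxy hy
    have hy0 : 0 < y := hx.trans_le hxy
    obtain ⟨n, hn1, hn2⟩ := exists_nat_pow_near_of_lt_one (div_pos hx hy0)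
      ((div_le_one hy0).2 hxy) ht ht1
    have hp : 0 < t ^ n := pow_pos ht n
    rw [lt_div_iff₀ hy0] at hn1
    rw [div_le_iff₀ hy0] at hn2
    have hz : 0 < x / t ^ n := div_pos hx hp
    have hzy : x / t ^ n ≤ y := by rw [div_le_iff₀ hp]; linarith
    have haz : t * y ≤ x / t ^ n := by
      rw [le_div_iff₀ hp]
      rw [pow_succ] at hn1
      linarith
    have h := hiter n (x / t ^ n) hz (hzy.trans hy)
    rw [div_mul_cancel₀ _ hp.ne'] at h
    exact h.trans (div_rpow_le_of_mul_le hinc hpos hγ ht hz hzy (hy.trans hε₀δ) haz)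
  have hlarge : ∀ x y : ℝ, ε₀ ≤ x → x ≤ y → y ≤ δ →
      ω x / x ^ γ ≤ C * ((ε₀ / δ) ^ γ)⁻¹ * (ω y / y ^ γ) := by
    intro x y hx hxy hy
    refine div_rpow_le_of_mul_le hinc hpos hγ (div_pos hε₀ hδ) (hε₀.trans_le hx) hxy hy ?_
    refine le_trans ?_ hx
    rw [div_mul_eq_mul_div, div_le_iff₀ hδ]
    gcongr
  have hK1 := hone t ht ht1.le
  have hK2 := hone (ε₀ / δ) (div_pos hε₀ hδ) ((div_le_one hδ).2 hε₀δ)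
  refine ⟨C * (t ^ γ)⁻¹ * (C * ((ε₀ / δ) ^ γ)⁻¹), one_le_mul_of_one_le_of_one_le hK1 hK2, ?_⟩
  intro x y hx hxy hy
  have hφ : 0 ≤ ω y / y ^ γ := div_nonneg (hpos y (hx.trans_le hxy) hy).le
    (Real.rpow_nonneg (hx.le.trans hxy) γ)
  set K₁ := C * (t ^ γ)⁻¹
  set K₂ := C * ((ε₀ / δ) ^ γ)⁻¹
  rcases le_total y ε₀ with h | h
  · refine (hsmall x y hx hxy h).trans ?_
    gcongr
    exact le_mul_of_one_le_right (by linarith) hK2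
  rcases le_total x ε₀ with h' | h'
  · refine (hsmall x ε₀ hx h' le_rfl).trans ?_
    exact (mul_le_mul_of_nonneg_left (hlarge ε₀ y le_rfl h hy) (by linarith)).trans_eq
      (mul_assoc _ _ _).symm
  · refine (hlarge x y h' hxy hy).trans ?_
    gcongr
    exact le_mul_of_one_le_left (by linarith) hK1

/-- If `ω t / t` is almost decreasing and `ω t / t ^ γ` is almost increasing, then `γ ≤ 1`. -/
lemma le_one_of_almost_increasing {δ C D γ : ℝ} {ω : ℝ → ℝ} (hδ : 0 < δ) (hC : 1 ≤ C)
    (hpos : ∀ t : ℝ, 0 < t → t ≤ δ → 0 < ω t)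
    (hdec : ∀ s t : ℝ, 0 < s → s ≤ t → t ≤ δ → ω t / t ≤ C * (ω s / s))
    (hinc : ∀ t s : ℝ, 0 < t → t ≤ s → s ≤ δ → ω t / t ^ γ ≤ D * (ω s / s ^ γ)) :
    γ ≤ 1 := by
  by_contra! hγ
  have hlim : Tendsto (fun t : ℝ => C * (D * (ω δ / δ ^ γ)) * t ^ (γ - 1)) (𝓝[>] 0) (𝓝 0) := by
    have h : ContinuousAt (fun t : ℝ => C * (D * (ω δ / δ ^ γ)) * t ^ (γ - 1)) 0 :=
      continuousAt_const.mul (Real.continuousAt_rpow_const _ _ (Or.inr (by linarith)))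
    have h0 := h.tendsto.mono_left (nhdsWithin_le_nhds (s := Set.Ioi (0 : ℝ)))
    simpa [Real.zero_rpow (show γ - 1 ≠ 0 by linarith)] using h0
  have hle : ∀ᶠ t : ℝ in 𝓝[>] 0, ω δ / δ ≤ C * (D * (ω δ / δ ^ γ)) * t ^ (γ - 1) := by
    filter_upwards [Ioc_mem_nhdsGT hδ] with t ht
    have h1 := hdec t δ ht.1 ht.2 le_rfl
    have h2 := hinc t δ ht.1 ht.2 le_rfl
    have h3 : 0 < t ^ (γ - 1) := Real.rpow_pos_of_pos ht.1 _
    have h4 : ω t / t = ω t / t ^ γ * t ^ (γ - 1) := by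
      rw [Real.rpow_sub_one ht.1.ne']
      have h5 : 0 < t ^ γ := Real.rpow_pos_of_pos ht.1 _
      have := ht.1
      field_simp
    rw [h4] at h1
    calc ω δ / δ ≤ C * (ω t / t ^ γ * t ^ (γ - 1)) := h1
      _ ≤ C * (D * (ω δ / δ ^ γ) * t ^ (γ - 1)) := by gcongr
      _ = _ := by ring
  exact (div_pos (hpos δ hδ le_rfl) hδ).not_ge (ge_of_tendsto hlim hle)

/-- `m(ω)` equals the supremum of exponents `γ > 0` for which `ω t / t^γ`
is almost increasing on `(0, δ0]`. -/
theorem lowerIndex_eq_sSup (δ0 : ℝ) (hδ0 : 0 < δ0) (ω : ℝ → ℝ)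
    (hω : IsModulusOfContinuity δ0 ω)
    (hpos : ∀ t : ℝ, 0 < t → t ≤ δ0 → 0 < ω t) :
    lowerIndex ω = sSup { γ : ℝ | 0 < γ ∧ ∃ C : ℝ, 1 ≤ C ∧
      ∀ t s : ℝ, 0 < t → t ≤ s → s ≤ δ0 → ω t / t ^ γ ≤ C * (ω s / s ^ γ) } := by
  obtain ⟨-, -, -, ⟨C, hC, hinc⟩, ⟨C', hC', hdec⟩⟩ := hω
  set S := { γ : ℝ | 0 < γ ∧ ∃ C : ℝ, 1 ≤ C ∧
      ∀ t s : ℝ, 0 < t → t ≤ s → s ≤ δ0 → ω t / t ^ γ ≤ C * (ω s / s ^ γ) } with hS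
  have hSbdd : BddAbove S := ⟨1, fun γ ⟨_, D, _, hD⟩ =>
    le_one_of_almost_increasing hδ0 hC' hpos hdec hD⟩
  have hS0 : 0 ≤ sSup S := Real.sSup_nonneg fun γ hγ => hγ.1.le
  have hupper : ∀ t : ℝ, 0 < t → t < 1 → ∀ᶠ ε : ℝ in 𝓝[>] 0, ω (ε * t) / ω ε ≤ C := by
    intro t ht ht1
    filter_upwards [Ioc_mem_nhdsGT hδ0] with ε hε
    rw [div_le_iff₀ (hpos ε hε.1 hε.2)]
    exact hinc _ _ (mul_nonneg hε.1.le ht.le) (mul_le_of_le_one_right hε.1.le ht1.le) hε.2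
  have hlower : ∀ t : ℝ, 0 < t → t < 1 → ∀ᶠ ε : ℝ in 𝓝[>] 0, t / C' ≤ ω (ε * t) / ω ε := by
    intro t ht ht1
    filter_upwards [Ioc_mem_nhdsGT hδ0] with ε hε
    have hε0 := hε.1
    have h := hdec (ε * t) ε (mul_pos hε.1 ht) (mul_le_of_le_one_right hε.1.le ht1.le) hε.2
    rw [← mul_div_assoc, div_le_div_iff₀ hε.1 (mul_pos hε.1 ht)] at h
    rw [div_le_div_iff₀ (by linarith) (hpos ε hε.1 hε.2)]
    nlinarith
  have hbdd : ∀ t : ℝ, 0 < t → t < 1 →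
      IsBoundedUnder (· ≤ ·) (𝓝[>] (0 : ℝ)) fun ε => ω (ε * t) / ω ε :=
    fun t ht ht1 => isBoundedUnder_of_eventually_le (hupper t ht ht1)
  have hcobdd : ∀ t : ℝ, 0 < t → t < 1 →
      IsCoboundedUnder (· ≤ ·) (𝓝[>] (0 : ℝ)) fun ε => ω (ε * t) / ω ε :=
    fun t ht ht1 => (isBoundedUnder_of_eventually_ge (hlower t ht ht1)).isCoboundedUnder_flip
  have hfpos : ∀ t : ℝ, 0 < t → t < 1 →
      0 < limsup (fun ε => ω (ε * t) / ω ε) (𝓝[>] (0 : ℝ)) := fun t ht ht1 =>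
    (div_pos ht (by linarith)).trans_le
      (le_limsup_of_frequently_le (hlower t ht ht1).frequently (hbdd t ht ht1))
  have hle : ∀ t : ℝ, 0 < t → t < 1 →
      Real.log (limsup (fun ε => ω (ε * t) / ω ε) (𝓝[>] (0 : ℝ))) / Real.log t ≤ sSup S := by
    intro t ht ht1
    have hlog : Real.log t < 0 := Real.log_neg ht ht1
    refine le_of_forall_lt fun γ hγ => ?_
    obtain ⟨γ', h1, h2⟩ := exists_between hγ
    rcases le_or_gt γ' 0 with h0 | h0
    · exact h1.trans_le (h0.trans hS0)
    refine h1.trans_le (le_csSup hSbdd ⟨h0, ?_⟩)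
    rw [lt_div_iff_of_neg hlog, ← Real.log_rpow ht] at h2
    have h3 := (Real.log_lt_log_iff (hfpos t ht ht1) (Real.rpow_pos_of_pos ht γ')).1 h2
    have h4 := (eventually_lt_of_limsup_lt h3 (hbdd t ht ht1)).and (Ioc_mem_nhdsGT hδ0)
    obtain ⟨ε₀, hε₀, hsub⟩ := (mem_nhdsGT_iff_exists_Ioc_subset).1 h4
    refine exists_almost_increasing_of_step hC hinc hpos h0 hε₀
      (hsub ⟨hε₀, le_rfl⟩).2.2 ht ht1 fun ε hε hε' => ?_
    have h5 := hsub ⟨hε, hε'⟩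
    exact ((div_lt_iff₀ (hpos ε hε h5.2.2)).1 h5.1).le
  have hge : ∀ γ D : ℝ, 1 ≤ D →
      (∀ t s : ℝ, 0 < t → t ≤ s → s ≤ δ0 → ω t / t ^ γ ≤ D * (ω s / s ^ γ)) →
      γ ≤ lowerIndex ω := by
    intro γ D hD hφ
    have hlim : Tendsto (fun t : ℝ => γ + Real.log D / Real.log t) (𝓝[>] 0) (𝓝 γ) := by
      simpa using tendsto_const_nhds.add (Real.tendsto_log_nhdsGT_zero.const_div_atBot (Real.log D))
    refine le_of_tendsto hlim ?_
    filter_upwards [Ioo_mem_nhdsGT (zero_lt_one' ℝ)] with t ⟨ht, ht1⟩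
    have hlog : Real.log t < 0 := Real.log_neg ht ht1
    have hf : limsup (fun ε => ω (ε * t) / ω ε) (𝓝[>] (0 : ℝ)) ≤ D * t ^ γ := by
      refine limsup_le_of_le (hcobdd t ht ht1) ?_
      filter_upwards [Ioc_mem_nhdsGT hδ0] with ε hε
      have h := hφ (ε * t) ε (mul_pos hε.1 ht) (mul_le_of_le_one_right hε.1.le ht1.le) hε.2
      have h5 : 0 < ε ^ γ := Real.rpow_pos_of_pos hε.1 γ
      have h6 : 0 < t ^ γ := Real.rpow_pos_of_pos ht γ
      rw [Real.mul_rpow hε.1.le ht.le, div_le_iff₀ (by positivity)] at h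
      rw [div_le_iff₀ (hpos ε hε.1 hε.2)]
      refine h.trans_eq ?_
      field_simp
    refine le_trans ?_ (le_csSup (s := { r : ℝ | ∃ t : ℝ, 0 < t ∧ t < 1 ∧
      r = Real.log (limsup (fun ε => ω (ε * t) / ω ε) (𝓝[>] (0 : ℝ))) / Real.log t })
      ⟨sSup S, ?_⟩ ⟨t, ht, ht1, rfl⟩)
    · rw [le_div_iff_of_neg hlog, add_mul, div_mul_cancel₀ _ hlog.ne, ← Real.log_rpow ht,
        add_comm, ← Real.log_mul (by linarith) (Real.rpow_pos_of_pos ht γ).ne']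
      exact Real.log_le_log (hfpos t ht ht1) hf
    · rintro r ⟨u, hu, hu1, rfl⟩
      exact hle u hu hu1
  apply le_antisymm
  · refine Real.sSup_le ?_ hS0
    rintro r ⟨u, hu, hu1, rfl⟩
    exact hle u hu hu1
  · refine Real.sSup_le (fun γ ⟨_, D, hD, h⟩ => hge γ D hD h) (hge 0 C hC fun t s ht hts hs => ?_)
    simpa using hinc t s ht.le hts hs
end

section
/- Let ω be a modulus of continuity on [0, δ0], let δ > 0 be such that t ↦ ω(t)/t^δ is almost increasing on (0, δ0], let α > 1/4 and q ∈ [1, ∞), and let g : ℝ → ℂ be measurable. Suppose there exist A > 0 and h₀ ∈ (0, δ0] such that for all h ∈ (0, h₀], ∫_{1/h ≤ |λ| ≤ 2/h} |g(λ)|^q |λ|^{2α−1} dλ ≤ A ω(h)^q. Then there exists A' > 0 such that for all h ∈ (0, h₀], ∫_{|λ| ≥ 1/h} |g(λ)|^q |λ|^{2α−1} dλ ≤ A' ω(h)^q. -/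
open MeasureTheory Filter Topology

/-- A nonnegative function whose integrals over the dyadic annuli `2 ^ n / h ≤ |l| ≤ 2 ^ (n + 1) / h`
are bounded by a geometric sequence has its integral over `1 / h ≤ |l|` bounded by the sum. -/
theorem setIntegral_exterior_le_of_annuli_le_geometric {f : ℝ → ℝ} (hf : ∀ l, 0 ≤ f l) {h : ℝ}
    (hh : 0 < h) (hint : IntegrableOn f {l : ℝ | 1 / h ≤ |l|}) {B r : ℝ} (hr : 0 ≤ r) (hr1 : r < 1)
    (hB : ∀ n : ℕ, ∫ l in {l : ℝ | 1 / (h / 2 ^ n) ≤ |l| ∧ |l| ≤ 2 / (h / 2 ^ n)}, f l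
      ≤ B * r ^ n) :
    ∫ l in {l : ℝ | 1 / h ≤ |l|}, f l ≤ B * (1 - r)⁻¹ := by
  let a : ℕ → ℝ := fun n => 2 ^ n / h
  have ha : Monotone a := fun m n hmn => by
    have : (2 : ℝ) ^ m ≤ 2 ^ n := pow_le_pow_right₀ one_le_two hmn
    exact div_le_div_of_nonneg_right this hh.le
  have ha_top : Tendsto a atTop atTop :=
    (tendsto_pow_atTop_atTop_of_one_lt one_lt_two).atTop_div_const hh
  let S : ℕ → Set ℝ := fun n => (fun l : ℝ => |l|) ⁻¹' Set.Ico (a n) (a (Order.succ n))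
  have hS_union : ⋃ n, S n = {l : ℝ | 1 / h ≤ |l|} := by
    rw [← Set.preimage_iUnion, iUnion_Ico_map_succ_eq_Ici (fun n => ha bot_le)
      (not_bddAbove_of_tendsto_atTop ha_top)]
    ext l
    simp [a]
  have hS_meas : ∀ n, MeasurableSet (S n) := fun n =>
    measurableSet_Ico.preimage continuous_abs.measurable
  have hS_disj : Pairwise (Function.onFun Disjoint S) :=
    fun m n hmn => (ha.pairwise_disjoint_on_Ico_succ hmn).preimage _
  have hsum := hasSum_integral_iUnion hS_meas hS_disj (hS_union ▸ hint)
  rw [hS_union] at hsum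
  refine hasSum_le (fun n => ?_) hsum ((hasSum_geometric_of_lt_one hr hr1).mul_left B)
  refine le_trans (setIntegral_mono_set (hint.mono_set fun l hl => ?_) ?_ ?_) (hB n)
  · refine le_trans ?_ hl.1
    rw [one_div_div]
    simpa [a] using ha (Nat.zero_le n)
  · exact Eventually.of_forall hf
  · refine Eventually.of_forall fun l hl => ⟨?_, ?_⟩
    · rw [one_div_div]
      exact hl.1
    · have : a (Order.succ n) = 2 / (h / 2 ^ n) := by
        simp only [a, Nat.succ_eq_succ, pow_succ]
        field_simp
      exact this ▸ hl.2.le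

/-- If `ω t / t ^ δ` is almost increasing, then `ω` decays geometrically along `h / 2 ^ n`. -/
theorem apply_div_two_pow_le_of_almost_increasing {ω : ℝ → ℝ} {δ δ0 C : ℝ}
    (hC : ∀ t s : ℝ, 0 < t → t ≤ s → s ≤ δ0 → ω t / t ^ δ ≤ C * (ω s / s ^ δ))
    {h : ℝ} (hh : 0 < h) (hhδ0 : h ≤ δ0) (n : ℕ) :
    ω (h / 2 ^ n) ≤ C * ω h * ((2 : ℝ) ^ (-δ)) ^ n := by
  have h2n : (0 : ℝ) < 2 ^ n := by positivity
  have key := hC (h / 2 ^ n) h (by positivity) (div_le_self hh.le (one_le_pow₀ one_le_two)) hhδ0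
  rw [div_le_iff₀ (by positivity)] at key
  refine key.trans_eq ?_
  have hpow : ((2 : ℝ) ^ (-δ)) ^ n = ((2 ^ n : ℝ) ^ δ)⁻¹ := by
    rw [← Real.rpow_mul_natCast two_pos.le, mul_comm, Real.rpow_natCast_mul two_pos.le,
      Real.rpow_neg h2n.le]
  have hhδ : h ^ δ ≠ 0 := (Real.rpow_pos_of_pos hh δ).ne'
  rw [Real.div_rpow hh.le h2n.le, hpow]
  field_simp

/-- From a bound on dyadic annuli controlled by a modulus of continuity with
`ω(t)/t^δ` almost increasing, deduce the bound on the full exterior region. -/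
theorem annuli_to_exterior_bound
    (δ0 : ℝ) (hδ0 : 0 < δ0) (ω : ℝ → ℝ) (hω : IsModulusOfContinuity δ0 ω)
    (δ : ℝ) (hδ : 0 < δ)
    (hai : ∃ C : ℝ, 1 ≤ C ∧ ∀ t s : ℝ, 0 < t → t ≤ s → s ≤ δ0 →
      ω t / t ^ δ ≤ C * (ω s / s ^ δ))
    (α : ℝ) (hα : 1 / 4 < α) (q : ℝ) (hq : 1 ≤ q)
    (g : ℝ → ℂ) (hg : Measurable g)
    (A : ℝ) (hA : 0 < A) (h₀ : ℝ) (hh₀ : 0 < h₀) (hh₀' : h₀ ≤ δ0)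
    (hyp : ∀ h : ℝ, 0 < h → h ≤ h₀ →
      (∫ l in {l : ℝ | 1 / h ≤ |l| ∧ |l| ≤ 2 / h}, ‖g l‖ ^ q * |l| ^ (2 * α - 1))
        ≤ A * ω h ^ q) :
    ∃ A' : ℝ, 0 < A' ∧ ∀ h : ℝ, 0 < h → h ≤ h₀ →
      (∫ l in {l : ℝ | 1 / h ≤ |l|}, ‖g l‖ ^ q * |l| ^ (2 * α - 1))
        ≤ A' * ω h ^ q := by
  obtain ⟨-, -, hω_nonneg, -, -⟩ := hω
  obtain ⟨C, hC1, hC⟩ := hai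
  have hC0 : 0 < C := one_pos.trans_le hC1
  have hq0 : 0 < q := one_pos.trans_le hq
  set ρ : ℝ := (2 : ℝ) ^ (-δ)
  have hρ0 : 0 < ρ := by positivity
  have hρ1 : ρ < 1 := Real.rpow_lt_one_of_one_lt_of_neg one_lt_two (neg_lt_zero.2 hδ)
  have hr0 : 0 < ρ ^ q := by positivity
  have hr1 : ρ ^ q < 1 := Real.rpow_lt_one hρ0.le hρ1 hq0
  have hr1' : 0 < (1 - ρ ^ q)⁻¹ := inv_pos.2 (sub_pos.2 hr1)
  refine ⟨A * C ^ q * (1 - ρ ^ q)⁻¹, by positivity, fun h hh hhh₀ => ?_⟩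
  have hωh : 0 ≤ ω h := hω_nonneg h ⟨hh.le, hhh₀.trans hh₀'⟩
  by_cases hint : IntegrableOn (fun l : ℝ => ‖g l‖ ^ q * |l| ^ (2 * α - 1)) {l : ℝ | 1 / h ≤ |l|}
  swap
  · rw [integral_undef hint]
    positivity
  have hB := setIntegral_exterior_le_of_annuli_le_geometric (B := A * (C * ω h) ^ q)
    (fun l => by positivity) hh hint hr0.le hr1 fun n => ?_
  · refine hB.trans_eq ?_
    rw [Real.mul_rpow hC0.le hωh]
    ring
  · have hle : h / 2 ^ n ≤ h := div_le_self hh.le (one_le_pow₀ one_le_two)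
    have hpos : 0 < h / 2 ^ n := by positivity
    have hdecay := apply_div_two_pow_le_of_almost_increasing hC hh (hhh₀.trans hh₀') n
    calc _ ≤ A * ω (h / 2 ^ n) ^ q := hyp _ hpos (hle.trans hhh₀)
      _ ≤ A * (C * ω h * ρ ^ n) ^ q := by
        have := hω_nonneg _ ⟨hpos.le, (hle.trans hhh₀).trans hh₀'⟩
        gcongr
      _ = A * (C * ω h) ^ q * (ρ ^ q) ^ n := by
        rw [Real.mul_rpow (by positivity) (by positivity), Real.rpow_pow_comm hρ0.le, mul_assoc]
end

section
/- Let α > 1/4. Let ω : [0, ∞) → [0, ∞) be a modulus of continuity on [0, δ0] which is bounded below on [δ0, ∞) by a positive number, satisfies the Zygmund condition (Z2) on (0, δ0], and is such that t ↦ ω(t)²/t³ is integrable on [δ0, ∞). Let g : (0, ∞) → ℂ be measurable with φ(t) := ∫_t^∞ |g(s)|² s^{2α−1} ds finite for every t > 0 and suppose there is C > 0 with φ(t) ≤ C ω(1/t)² for all t > 0. Then there exists C' > 0 such that for all x ≥ 1/δ0, ∫_0^x t² |g(t)|² t^{2α−1} dt ≤ C' (x² ω(1/x)² + 1). -/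
open MeasureTheory

/-- Layer-cake estimate: a weighted integral of `t² h(t)` is controlled by the tails of `h`. -/
theorem lintegral_sq_mul_le_of_tail_le {h ψ : ℝ → ℝ} (hh : Measurable h)
    (hnn : ∀ t, 0 < t → 0 ≤ h t)
    (hint : ∀ t, 0 < t → IntegrableOn h (Set.Ioi t))
    (htail : ∀ t, 0 < t → (∫ s in Set.Ioi t, h s) ≤ ψ t) (x : ℝ) :
    ∫⁻ t in Set.Ioc 0 x, ENNReal.ofReal (t ^ 2 * h t) ≤
      ∫⁻ t in Set.Ioc 0 x, ENNReal.ofReal (ψ t) * ENNReal.ofReal (2 * t) := by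
  have hmeas : Measurable fun t => ENNReal.ofReal (h t) := hh.ennreal_ofReal
  set μ : Measure ℝ :=
    (volume.restrict (Set.Ioc 0 x)).withDensity fun t => ENNReal.ofReal (h t) with hμ
  have hlayer := lintegral_comp_eq_lintegral_meas_le_mul μ (f := fun t : ℝ => t)
    (g := fun t : ℝ => 2 * t)
    ((withDensity_absolutelyContinuous _ _).ae_le
      ((ae_restrict_mem measurableSet_Ioc).mono fun t ht => ht.1.le))
    aemeasurable_id
    (fun t _ => (by fun_prop : Continuous fun t : ℝ => 2 * t).intervalIntegrable _ _)
    ((ae_restrict_mem measurableSet_Ioi).mono fun t (ht : 0 < t) => by positivity)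
  have hsq : ∀ t : ℝ, (∫ u in (0:ℝ)..t, 2 * u) = t ^ 2 := fun t => by
    rw [intervalIntegral.integral_const_mul, integral_id]; ring
  simp only [hsq] at hlayer
  have hleft : ∫⁻ t, ENNReal.ofReal (t ^ 2) ∂μ =
      ∫⁻ t in Set.Ioc 0 x, ENNReal.ofReal (t ^ 2 * h t) := by
    rw [hμ, lintegral_withDensity_eq_lintegral_mul _ hmeas (by fun_prop)]
    refine lintegral_congr fun t => ?_
    rw [Pi.mul_apply, ENNReal.ofReal_mul (sq_nonneg t), mul_comm]
  rw [← hleft, hlayer, ← lintegral_indicator measurableSet_Ioi,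
    ← lintegral_indicator measurableSet_Ioc]
  refine lintegral_mono fun t => ?_
  by_cases ht : 0 < t
  · rw [Set.indicator_of_mem (Set.mem_Ioi.2 ht)]
    have hset : MeasurableSet {a : ℝ | t ≤ a} := measurableSet_Ici
    have hμt : μ {a : ℝ | t ≤ a} =
        ∫⁻ a in {a : ℝ | t ≤ a} ∩ Set.Ioc 0 x, ENNReal.ofReal (h a) := by
      rw [hμ, withDensity_apply _ hset, Measure.restrict_restrict hset]
    by_cases htx : t ≤ x
    · rw [Set.indicator_of_mem (Set.mem_Ioc.2 ⟨ht, htx⟩)]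
      gcongr
      calc μ {a : ℝ | t ≤ a}
          ≤ ∫⁻ a in Set.Ici t, ENNReal.ofReal (h a) := by
            rw [hμt]; exact lintegral_mono_set Set.inter_subset_left
        _ = ∫⁻ a in Set.Ioi t, ENNReal.ofReal (h a) := by
            rw [restrict_Ioi_eq_restrict_Ici]
        _ = ENNReal.ofReal (∫ a in Set.Ioi t, h a) := by
            rw [ofReal_integral_eq_lintegral_ofReal (hint t ht)]
            exact (ae_restrict_mem measurableSet_Ioi).mono fun a ha => hnn a (ht.trans ha)
        _ ≤ ENNReal.ofReal (ψ t) := ENNReal.ofReal_le_ofReal (htail t ht)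
    · have hempty : {a : ℝ | t ≤ a} ∩ Set.Ioc 0 x = ∅ := by
        ext a
        simp only [Set.mem_inter_iff, Set.mem_ofPred_eq, Set.mem_Ioc, Set.mem_empty_iff_false,
          iff_false]
        rintro ⟨h1, -, h2⟩
        exact htx (h1.trans h2)
      simp [hμt, hempty]
  · rw [Set.indicator_of_notMem (by simpa using ht)]
    exact zero_le

/-- The substitution `t = 1 / v` for lower integrals on `(0, x]`. -/
theorem lintegral_Ioc_eq_lintegral_Ici_inv {x : ℝ} (hx : 0 < x) (F : ℝ → ENNReal) :
    ∫⁻ t in Set.Ioc 0 x, F t =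
      ∫⁻ v in Set.Ici x⁻¹, ENNReal.ofReal ((v ^ 2)⁻¹) * F v⁻¹ := by
  have himage : (fun v : ℝ => v⁻¹) '' Set.Ici x⁻¹ = Set.Ioc 0 x := by
    ext t
    constructor
    · rintro ⟨v, hv, rfl⟩
      have hv0 : 0 < v := (inv_pos.2 hx).trans_le hv
      exact ⟨inv_pos.2 hv0, inv_le_of_inv_le₀ hx hv⟩
    · rintro ⟨h0, hx'⟩
      exact ⟨t⁻¹, inv_anti₀ h0 hx', inv_inv t⟩
  rw [← himage, lintegral_image_eq_lintegral_abs_deriv_mul measurableSet_Ici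
    (fun v hv => (hasDerivAt_inv ((inv_pos.2 hx).trans_le hv).ne').hasDerivWithinAt)
    (inv_injective.injOn)]
  refine lintegral_congr fun v => ?_
  rw [abs_neg, abs_of_nonneg (by positivity)]

/-- Under the Zygmund condition the integral of `ω(t)² / t³` near `0` is `O(ω(t)² / t²)`. -/
theorem lintegral_sq_div_cube_le {δ0 a K L : ℝ} {ω : ℝ → ℝ} (ha : 0 < a) (haδ : a ≤ δ0)
    (hcont : ContinuousOn ω (Set.Icc 0 δ0)) (hnn : ∀ t, 0 ≤ t → 0 ≤ ω t) (hK : 0 ≤ K)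
    (hdec : ∀ t, a ≤ t → t ≤ δ0 → ω t / t ≤ K * (ω a / a))
    (hZ : (∫ t in a..δ0, ω t / t ^ 2) ≤ L * (ω a / a)) :
    ∫⁻ t in Set.Ioc a δ0, ENNReal.ofReal (ω t ^ 2 / t ^ 3) ≤
      ENNReal.ofReal (K * L * (ω a / a) ^ 2) := by
  have hωa : 0 ≤ ω a / a := div_nonneg (hnn a ha.le) ha.le
  have hint : IntegrableOn (fun t => ω t / t ^ 2) (Set.Ioc a δ0) := by
    refine (ContinuousOn.integrableOn_Icc ?_).mono_set Set.Ioc_subset_Icc_self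
    exact (hcont.mono (Set.Icc_subset_Icc_left ha.le)).div (by fun_prop)
      fun t ht => (pow_pos (ha.trans_le ht.1) 2).ne'
  calc ∫⁻ t in Set.Ioc a δ0, ENNReal.ofReal (ω t ^ 2 / t ^ 3)
      ≤ ∫⁻ t in Set.Ioc a δ0, ENNReal.ofReal (K * (ω a / a) * (ω t / t ^ 2)) := by
        refine setLIntegral_mono' measurableSet_Ioc fun t ht => ENNReal.ofReal_le_ofReal ?_
        have ht0 : 0 < t := ha.trans ht.1
        have hωt := hnn t ht0.le
        calc ω t ^ 2 / t ^ 3 = ω t / t * (ω t / t ^ 2) := by field_simp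
          _ ≤ K * (ω a / a) * (ω t / t ^ 2) :=
            mul_le_mul_of_nonneg_right (hdec t ht.1.le ht.2) (by positivity)
    _ = ENNReal.ofReal (∫ t in Set.Ioc a δ0, K * (ω a / a) * (ω t / t ^ 2)) := by
        rw [ofReal_integral_eq_lintegral_ofReal (hint.const_mul _)]
        refine (ae_restrict_mem measurableSet_Ioc).mono fun t ht => ?_
        have hωt := hnn t (ha.trans ht.1).le
        exact mul_nonneg (mul_nonneg hK hωa) (by positivity)
    _ ≤ ENNReal.ofReal (K * L * (ω a / a) ^ 2) := by
        refine ENNReal.ofReal_le_ofReal ?_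
        rw [integral_const_mul, ← intervalIntegral.integral_of_le haδ]
        calc K * (ω a / a) * ∫ t in a..δ0, ω t / t ^ 2
            ≤ K * (ω a / a) * (L * (ω a / a)) :=
              mul_le_mul_of_nonneg_left hZ (mul_nonneg hK hωa)
          _ = K * L * (ω a / a) ^ 2 := by ring

/-- From the tail bound `φ(t) = ∫_t^∞ |g(s)|² s^{2α-1} ds ≤ C ω(1/t)²` one deduces
`∫_0^x t² |g(t)|² t^{2α-1} dt ≤ C' (x² ω(1/x)² + 1)` for all `x ≥ 1/δ0`. -/
theorem tail_bound_to_weighted_bound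
    (δ0 : ℝ) (hδ0 : 0 < δ0) (α : ℝ) (hα : 1 / 4 < α)
    (ω : ℝ → ℝ) (hωnn : ∀ t : ℝ, 0 ≤ t → 0 ≤ ω t)
    (hω : IsModulusOfContinuity δ0 ω)
    (hbelow : ∃ c : ℝ, 0 < c ∧ ∀ t : ℝ, δ0 ≤ t → c ≤ ω t)
    (hZ2 : ∃ C : ℝ, 0 < C ∧ ∀ t : ℝ, 0 < t → t ≤ δ0 →
      (∫ x in t..δ0, ω x / x ^ 2) ≤ C * (ω t / t))
    (hint : IntegrableOn (fun t => ω t ^ 2 / t ^ 3) (Set.Ici δ0))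
    (g : ℝ → ℂ) (hg : Measurable g)
    (hφint : ∀ t : ℝ, 0 < t →
      IntegrableOn (fun s => ‖g s‖ ^ 2 * s ^ (2 * α - 1)) (Set.Ioi t))
    (C : ℝ) (hC : 0 < C)
    (hφ : ∀ t : ℝ, 0 < t →
      (∫ s in Set.Ioi t, ‖g s‖ ^ 2 * s ^ (2 * α - 1)) ≤ C * ω (1 / t) ^ 2) :
    ∃ C' : ℝ, 0 < C' ∧ ∀ x : ℝ, 1 / δ0 ≤ x →
      (∫ t in Set.Ioc (0:ℝ) x, t ^ 2 * ‖g t‖ ^ 2 * t ^ (2 * α - 1))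
        ≤ C' * (x ^ 2 * ω (1 / x) ^ 2 + 1) := by
  obtain ⟨-, hcont, -, -, K, hK1, hdec⟩ := hω
  obtain ⟨L, hL, hZ⟩ := hZ2
  have hK : 0 < K := one_pos.trans_le hK1
  set J := ∫ t in Set.Ici δ0, ω t ^ 2 / t ^ 3 with hJ
  have hnn : ∀ t ∈ Set.Ici δ0, 0 ≤ ω t ^ 2 / t ^ 3 := fun t ht => by
    have : 0 < t := hδ0.trans_le ht
    positivity
  have hJ0 : 0 ≤ J := setIntegral_nonneg measurableSet_Ici hnn
  refine ⟨2 * C * (K * L + J), by positivity, fun x hx => ?_⟩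
  have hx0 : 0 < x := (one_div_pos.2 hδ0).trans_le hx
  have ha : 0 < x⁻¹ := inv_pos.2 hx0
  have haδ : x⁻¹ ≤ δ0 := inv_le_of_inv_le₀ hδ0 (by simpa using hx)
  have htail : ∫⁻ v in Set.Ici x⁻¹, ENNReal.ofReal (ω v ^ 2 / v ^ 3) ≤
      ENNReal.ofReal (K * L * (ω x⁻¹ / x⁻¹) ^ 2 + J) := by
    have hsplit : Set.Ici x⁻¹ ⊆ {x⁻¹} ∪ Set.Ioc x⁻¹ δ0 ∪ Set.Ici δ0 := fun v hv => by
      rcases le_total δ0 v with h | h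
      · exact Or.inr h
      · rcases eq_or_lt_of_le (Set.mem_Ici.1 hv) with h' | h'
        · exact Or.inl (Or.inl h'.symm)
        · exact Or.inl (Or.inr ⟨h', h⟩)
    rw [ENNReal.ofReal_add (by positivity) hJ0]
    calc ∫⁻ v in Set.Ici x⁻¹, ENNReal.ofReal (ω v ^ 2 / v ^ 3)
        ≤ ∫⁻ v in {x⁻¹} ∪ Set.Ioc x⁻¹ δ0 ∪ Set.Ici δ0, ENNReal.ofReal (ω v ^ 2 / v ^ 3) :=
          lintegral_mono_set hsplit
      _ ≤ ((∫⁻ v in {x⁻¹}, ENNReal.ofReal (ω v ^ 2 / v ^ 3)) +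
            ∫⁻ v in Set.Ioc x⁻¹ δ0, ENNReal.ofReal (ω v ^ 2 / v ^ 3)) +
            ∫⁻ v in Set.Ici δ0, ENNReal.ofReal (ω v ^ 2 / v ^ 3) :=
          (lintegral_union_le _ _ _).trans (add_le_add_left (lintegral_union_le _ _ _) _)
      _ ≤ _ := by
          rw [setLIntegral_measure_zero _ _ (measure_singleton _), zero_add]
          refine add_le_add ?_ ?_
          · exact lintegral_sq_div_cube_le ha haδ hcont hωnn hK.le
              (fun t h1 h2 => hdec _ _ ha h1 h2) (hZ _ ha haδ)
          · rw [hJ, ofReal_integral_eq_lintegral_ofReal hint]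
            exact (ae_restrict_mem measurableSet_Ici).mono hnn
  have hmain : ∫⁻ t in Set.Ioc 0 x, ENNReal.ofReal (t ^ 2 * ‖g t‖ ^ 2 * t ^ (2 * α - 1)) ≤
      ENNReal.ofReal (2 * C * (K * L * (ω x⁻¹ / x⁻¹) ^ 2 + J)) := by
    simp only [mul_assoc (_ ^ 2) (‖g _‖ ^ 2)]
    refine (lintegral_sq_mul_le_of_tail_le (h := fun s => ‖g s‖ ^ 2 * s ^ (2 * α - 1))
      (ψ := fun t => C * ω (1 / t) ^ 2) (by fun_prop) (fun t ht => by positivity)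
      hφint hφ x).trans ?_
    rw [lintegral_Ioc_eq_lintegral_Ici_inv hx0, ENNReal.ofReal_mul (by positivity)]
    refine le_trans (le_of_eq ?_) (mul_le_mul_right htail _)
    rw [← lintegral_const_mul' _ _ ENNReal.ofReal_ne_top]
    refine setLIntegral_congr_fun measurableSet_Ici fun v hv => ?_
    have hv0 : 0 < v := ha.trans_le hv
    simp only [one_div, inv_inv]
    rw [← ENNReal.ofReal_mul (by positivity), ← ENNReal.ofReal_mul (by positivity),
      ← ENNReal.ofReal_mul (by positivity)]
    congr 1
    field_simp
  rw [integral_eq_lintegral_of_nonneg_ae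
    ((ae_restrict_mem measurableSet_Ioc).mono fun t ht => by
      have := ht.1
      simp only [Pi.zero_apply]
      positivity)
    (by fun_prop)]
  refine (ENNReal.toReal_le_of_le_ofReal (by positivity) hmain).trans ?_
  rw [one_div, div_inv_eq_mul, mul_assoc]
  have h1 : 0 ≤ J * (x ^ 2 * ω x⁻¹ ^ 2) := by positivity
  have h2 : 0 ≤ K * L := by positivity
  have h3 : K * L * (ω x⁻¹ * x) ^ 2 + J ≤ (K * L + J) * (x ^ 2 * ω x⁻¹ ^ 2 + 1) := by
    linarith
  calc _ = 2 * C * (K * L * (ω x⁻¹ * x) ^ 2 + J) := by ring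
    _ ≤ 2 * C * ((K * L + J) * (x ^ 2 * ω x⁻¹ ^ 2 + 1)) := by gcongr
    _ = _ := by ring
end

section
/- Let α > 1/4. Let ω : [0, ∞) → [0, ∞) be a modulus of continuity on [0, δ0] which is positive on (0, δ0], bounded below on [δ0, ∞) by a positive number, satisfies the Zygmund condition (Z2) on (0, δ0], and is such that t ↦ ω(t)²/t³ is integrable on [δ0, ∞). Let g : ℝ → ℂ be measurable with ∫_ℝ |g(λ)|² |λ|^{2α−1} dλ < ∞, and suppose there exists C > 0 such that ∫_{|λ| ≥ 1/h} |g(λ)|² |λ|^{2α−1} dλ ≤ C ω(h)² for all sufficiently small h > 0. Then there exists C' > 0 such that for all sufficiently small h > 0, ∫_ℝ |1 − B_α(λh)|² |g(λ)|² |λ|^{2α−1} dλ ≤ C' ω(h)². -/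
open MeasureTheory Filter Topology

/-- The normalized Bessel function of the first kind,
`j_β(x) = Γ(β+1) ∑_{k=0}^∞ (-1)^k / (k! Γ(k+β+1)) (x/2)^{2k}`. -/
noncomputable def besselNorm (β : ℝ) (x : ℝ) : ℝ :=
  Real.Gamma (β + 1) *
    ∑' k : ℕ, ((-1 : ℝ) ^ k / ((k.factorial : ℝ) * Real.Gamma (k + β + 1))) * (x / 2) ^ (2 * k)

/-- The deformed Hankel kernel
`B_α(t) = j_{2α-1}(2√|t|) - (Γ(2α)/Γ(2α+2)) t j_{2α+1}(2√|t|)`. -/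
noncomputable def deformedHankelKernel (α : ℝ) (t : ℝ) : ℝ :=
  besselNorm (2 * α - 1) (2 * Real.sqrt |t|) -
    (Real.Gamma (2 * α) / Real.Gamma (2 * α + 2)) * t * besselNorm (2 * α + 1) (2 * Real.sqrt |t|)

/-- The exponential generating function of a real sequence. -/
noncomputable def expGen (b : ℕ → ℝ) (u : ℝ) : ℝ := ∑' k : ℕ, b k * (u ^ k / k.factorial)

lemma summable_expGen {b : ℕ → ℝ} {M : ℝ} (hb : ∀ k, |b k| ≤ M) (u : ℝ) :
    Summable fun k : ℕ => b k * (u ^ k / k.factorial) := by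
  refine Summable.of_norm_bounded (g := fun k : ℕ => M * (|u| ^ k / k.factorial))
    ((Real.summable_pow_div_factorial |u|).mul_left M) fun k => ?_
  rw [norm_mul, norm_div, norm_pow, Real.norm_eq_abs, Real.norm_eq_abs, Real.norm_natCast]
  gcongr
  exact hb k

lemma mul_pow_pred_div_factorial (x : ℝ) (k : ℕ) :
    ((k + 1 : ℕ) : ℝ) * x ^ (k + 1 - 1) / ((k + 1).factorial : ℝ) = x ^ k / k.factorial := by
  rw [Nat.factorial_succ, Nat.add_sub_cancel]
  push_cast
  field_simp

lemma hasDerivAt_expGen {b : ℕ → ℝ} {M : ℝ} (hb : ∀ k, |b k| ≤ M) (u : ℝ) :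
    HasDerivAt (expGen b) (expGen (fun k => b (k + 1)) u) u := by
  set R : ℝ := |u| + 1 with hR
  have hu : u ∈ Metric.ball (0 : ℝ) R := by simp [hR]
  have hs : Summable fun k : ℕ => M * (k * R ^ (k - 1) / k.factorial) := by
    rw [← summable_nat_add_iff 1]
    simp_rw [mul_pow_pred_div_factorial]
    exact (Real.summable_pow_div_factorial R).mul_left M
  have hd : ∀ (k : ℕ) (y : ℝ), y ∈ Metric.ball (0 : ℝ) R →
      HasDerivAt (fun z => b k * (z ^ k / k.factorial))
        (b k * (k * y ^ (k - 1) / k.factorial)) y := fun k y _ =>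
    ((hasDerivAt_pow k y).div_const _).const_mul _
  have hbound : ∀ (k : ℕ) (y : ℝ), y ∈ Metric.ball (0 : ℝ) R →
      ‖b k * (k * y ^ (k - 1) / k.factorial)‖ ≤ M * (k * R ^ (k - 1) / k.factorial) := by
    intro k y hy
    have hy' : |y| ≤ R := by simpa using (mem_ball_zero_iff.mp hy).le
    have hM : 0 ≤ M := (abs_nonneg _).trans (hb 0)
    rw [norm_mul, norm_div, norm_mul, norm_pow, Real.norm_natCast, Real.norm_natCast,
      Real.norm_eq_abs, Real.norm_eq_abs]
    gcongr
    exact hb k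
  have key := hasDerivAt_tsum_of_isPreconnected hs Metric.isOpen_ball
    (convex_ball (0 : ℝ) R).isPreconnected hd hbound hu (summable_expGen hb u) hu
  have hsu : Summable fun k : ℕ => b k * (k * u ^ (k - 1) / k.factorial) :=
    Summable.of_norm_bounded hs fun k => hbound k u hu
  rw [hsu.tsum_eq_zero_add] at key
  simp_rw [mul_pow_pred_div_factorial] at key
  rw [Nat.cast_zero, zero_mul, zero_div, mul_zero, zero_add] at key
  exact key

lemma hasSum_natCast_mul_expGen {b : ℕ → ℝ} {M : ℝ} (hb : ∀ k, |b k| ≤ M) (u : ℝ) :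
    HasSum (fun k : ℕ => k * b k * (u ^ k / k.factorial)) (u * expGen (fun k => b (k + 1)) u) := by
  rw [← hasSum_nat_add_iff' 1]
  have h := (summable_expGen (b := fun k => b (k + 1)) (fun k => hb (k + 1)) u).hasSum.mul_left u
  simp only [Finset.range_one, Finset.sum_singleton, Nat.cast_zero, zero_mul, sub_zero]
  refine (congrArg (HasSum · _ _) (funext fun k => ?_)).mpr h
  rw [← mul_pow_pred_div_factorial u k, Nat.add_sub_cancel, pow_succ]
  ring

lemma expGen_zero (b : ℕ → ℝ) : expGen b 0 = b 0 := by
  rw [expGen, tsum_eq_single 0 (fun k hk => by simp [hk])]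
  simp

/-- The coefficients of the entire function `u ↦ j_β(2√u)` with respect to `u ^ k / k!`. -/
noncomputable def besselCoeff (β : ℝ) (k : ℕ) : ℝ :=
  (-1) ^ k * (Real.Gamma (β + 1) / Real.Gamma (k + β + 1))

lemma besselNorm_two_mul_sqrt (β : ℝ) {u : ℝ} (hu : 0 ≤ u) :
    besselNorm β (2 * √u) = expGen (besselCoeff β) u := by
  rw [besselNorm, expGen, ← tsum_mul_left]
  congr 1 with k
  rw [mul_div_cancel_left₀ _ (two_ne_zero), pow_mul, Real.sq_sqrt hu, besselCoeff]
  ring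

lemma besselCoeff_zero {β : ℝ} (hβ : -1 < β) : besselCoeff β 0 = 1 := by
  have := (Real.Gamma_pos_of_pos (show 0 < β + 1 by linarith)).ne'
  simp [besselCoeff, this]

lemma besselCoeff_succ {β : ℝ} (hβ : -1 < β) (k : ℕ) :
    (k + β + 1) * besselCoeff β (k + 1) = -besselCoeff β k := by
  have h : 0 < (k : ℝ) + β + 1 := by linarith [k.cast_nonneg (α := ℝ)]
  have hG := (Real.Gamma_pos_of_pos h).ne'
  have e : ((k + 1 : ℕ) : ℝ) + β + 1 = (k + β + 1) + 1 := by push_cast; ring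
  rw [besselCoeff, besselCoeff, e, Real.Gamma_add_one h.ne', pow_succ]
  field_simp

lemma besselCoeff_shift {β : ℝ} (hβ : -1 < β) (k : ℕ) :
    besselCoeff β (k + 1) = -(β + 1)⁻¹ * besselCoeff (β + 1) k := by
  have h : 0 < β + 1 := by linarith
  have e : ((k + 1 : ℕ) : ℝ) + β + 1 = k + (β + 1) + 1 := by push_cast; ring
  rw [besselCoeff, besselCoeff, e, Real.Gamma_add_one h.ne', pow_succ]
  field_simp

lemma abs_besselCoeff_le {β : ℝ} (hβ : -(1 / 2) ≤ β) (k : ℕ) : |besselCoeff β k| ≤ 2 := by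
  have h1 : ∀ k : ℕ, |besselCoeff β (k + 1)| ≤ 2 := by
    intro k
    induction k with
    | zero =>
      have h := congrArg abs (besselCoeff_succ (β := β) (by linarith) 0)
      rw [besselCoeff_zero (by linarith), abs_mul, abs_neg, abs_one,
        abs_of_nonneg (by push_cast; linarith)] at h
      push_cast at h
      nlinarith [abs_nonneg (besselCoeff β (0 + 1))]
    | succ n ih =>
      have h := congrArg abs (besselCoeff_succ (β := β) (by linarith) (n + 1))
      have hn : (0 : ℝ) ≤ n := n.cast_nonneg
      rw [abs_mul, abs_neg, abs_of_nonneg (by push_cast; linarith)] at h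
      push_cast at h
      nlinarith [abs_nonneg (besselCoeff β (n + 1 + 1))]
  cases k with
  | zero => rw [besselCoeff_zero (by linarith)]; norm_num
  | succ n => exact h1 n

/-- The differential equation `u F'' + (β + 1) F' + F = 0` for `F u = j_β(2√u)`. -/
lemma expGen_besselCoeff_ode {β : ℝ} (hβ : -(1 / 2) ≤ β) (u : ℝ) :
    u * expGen (fun k => besselCoeff β (k + 2)) u +
      (β + 1) * expGen (fun k => besselCoeff β (k + 1)) u + expGen (besselCoeff β) u = 0 := by
  have hb := abs_besselCoeff_le hβ
  have h := ((hasSum_natCast_mul_expGen (fun k => hb (k + 1)) u).add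
    ((summable_expGen (fun k => hb (k + 1)) u).hasSum.mul_left (β + 1))).add
    (summable_expGen hb u).hasSum
  refine h.unique ?_
  convert hasSum_zero with k
  linear_combination (u ^ k / k.factorial) * besselCoeff_succ (β := β) (by linarith) k

/-- The normalized Bessel function of order at least `-1/2` is bounded by `1`, since the energy
`F² + u F'²` of `F u = j_β(2√u)` is nonincreasing. -/
lemma abs_expGen_besselCoeff_le_one {β : ℝ} (hβ : -(1 / 2) ≤ β) {u : ℝ} (hu : 0 ≤ u) :
    |expGen (besselCoeff β) u| ≤ 1 := by
  have hb := abs_besselCoeff_le hβ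
  set F := expGen (besselCoeff β) with hF
  set F' := expGen (fun k => besselCoeff β (k + 1)) with hF'
  set F'' := expGen (fun k => besselCoeff β (k + 2)) with hF''
  have hE : ∀ x, HasDerivAt (fun y => F y ^ 2 + y * F' y ^ 2) (-(2 * β + 1) * F' x ^ 2) x := by
    intro x
    have h1 : HasDerivAt F (F' x) x := hasDerivAt_expGen hb x
    have h2 : HasDerivAt F' (F'' x) x := hasDerivAt_expGen (fun k => hb (k + 1)) x
    refine ((h1.fun_pow 2).fun_add ((hasDerivAt_id' x).fun_mul (h2.fun_pow 2))).congr_deriv ?_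
    have := expGen_besselCoeff_ode hβ x
    push_cast
    linear_combination (2 * F' x) * this
  have hanti : Antitone fun y => F y ^ 2 + y * F' y ^ 2 :=
    antitone_of_hasDerivAt_nonpos hE fun x => by
      have : 0 ≤ 2 * β + 1 := by linarith
      have := mul_nonneg this (sq_nonneg (F' x))
      simp only [Pi.zero_apply]
      linarith
  have h := hanti hu
  have h0 : F 0 = 1 := by rw [hF, expGen_zero, besselCoeff_zero (by linarith)]
  simp only [h0, zero_mul] at h
  rw [← sq_le_one_iff_abs_le_one]
  have := mul_nonneg hu (sq_nonneg (F' u))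
  linarith

lemma expGen_besselCoeff_shift {β : ℝ} (hβ : -1 < β) (u : ℝ) :
    expGen (fun k => besselCoeff β (k + 1)) u =
      -(β + 1)⁻¹ * expGen (besselCoeff (β + 1)) u := by
  simp_rw [expGen, besselCoeff_shift hβ, mul_assoc, tsum_mul_left]

lemma expGen_besselCoeff_shift_two {β : ℝ} (hβ : -1 < β) (u : ℝ) :
    expGen (fun k => besselCoeff β (k + 2)) u =
      Real.Gamma (β + 1) / Real.Gamma (β + 3) * expGen (besselCoeff (β + 2)) u := by
  have h1 : β + 1 ≠ 0 := by linarith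
  have h2 : β + 1 + 1 ≠ 0 := by linarith
  have hG := (Real.Gamma_pos_of_pos (show 0 < β + 1 by linarith)).ne'
  have e : ∀ k, besselCoeff β (k + 2) =
      (Real.Gamma (β + 1) / Real.Gamma (β + 3)) * besselCoeff (β + 2) k := by
    intro k
    rw [besselCoeff_shift hβ (k + 1), besselCoeff_shift (by linarith),
      show β + 3 = β + 1 + 1 + 1 by ring, Real.Gamma_add_one h2, Real.Gamma_add_one h1,
      show β + 2 = β + 1 + 1 by ring]
    field_simp
  simp_rw [expGen, e, mul_assoc, tsum_mul_left]

lemma deformedHankelKernel_eq {α : ℝ} (hα : 1 / 4 < α) (t : ℝ) :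
    deformedHankelKernel α t = expGen (besselCoeff (2 * α - 1)) (|t|) -
      t * expGen (fun k => besselCoeff (2 * α - 1) (k + 2)) (|t|) := by
  rw [deformedHankelKernel, besselNorm_two_mul_sqrt _ (abs_nonneg t),
    besselNorm_two_mul_sqrt _ (abs_nonneg t), expGen_besselCoeff_shift_two (by linarith),
    show 2 * α - 1 + 1 = 2 * α by ring, show 2 * α - 1 + 3 = 2 * α + 2 by ring,
    show 2 * α - 1 + 2 = 2 * α + 1 by ring]
  ring

lemma abs_one_sub_deformedHankelKernel_le_four {α : ℝ} (hα : 1 / 4 < α) (t : ℝ) :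
    |1 - deformedHankelKernel α t| ≤ 4 := by
  have hβ : -(1 / 2) ≤ 2 * α - 1 := by linarith
  have h0 := abs_expGen_besselCoeff_le_one hβ (abs_nonneg t)
  have h1 := abs_expGen_besselCoeff_le_one (β := 2 * α - 1 + 1) (by linarith) (abs_nonneg t)
  have hode := expGen_besselCoeff_ode hβ |t|
  rw [expGen_besselCoeff_shift (by linarith), neg_mul, mul_neg, mul_inv_cancel_left₀ (by linarith)]
    at hode
  have h2 : |t * expGen (fun k => besselCoeff (2 * α - 1) (k + 2)) (|t|)| ≤ 2 := by
    rw [abs_mul, ← abs_abs t, ← abs_mul, abs_abs t]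
    rw [abs_le] at *
    constructor <;> linarith
  rw [deformedHankelKernel_eq hα]
  rw [abs_le] at *
  constructor <;> linarith

lemma exists_abs_one_sub_deformedHankelKernel_le {α : ℝ} (hα : 1 / 4 < α) :
    ∃ K : ℝ, 0 < K ∧ ∀ t, |1 - deformedHankelKernel α t| ≤ K * |t| := by
  have hβ : -(1 / 2) ≤ 2 * α - 1 := by linarith
  have hα0 : 0 < 2 * α := by linarith
  have hc : 0 < Real.Gamma (2 * α - 1 + 1) / Real.Gamma (2 * α - 1 + 3) :=
    div_pos (Real.Gamma_pos_of_pos (by linarith)) (Real.Gamma_pos_of_pos (by linarith))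
  refine ⟨(2 * α)⁻¹ + Real.Gamma (2 * α - 1 + 1) / Real.Gamma (2 * α - 1 + 3), by positivity,
    fun t => ?_⟩
  have hF : |expGen (besselCoeff (2 * α - 1)) (|t|) - 1| ≤ (2 * α)⁻¹ * |t| := by
    have h := (convex_Ici (0 : ℝ)).norm_image_sub_le_of_norm_hasDerivWithin_le
      (f := expGen (besselCoeff (2 * α - 1))) (C := (2 * α)⁻¹)
      (fun x _ => (hasDerivAt_expGen (abs_besselCoeff_le hβ) x).hasDerivWithinAt)
      (fun x hx => by
        rw [expGen_besselCoeff_shift (by linarith), norm_mul, norm_neg, sub_add_cancel,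
          Real.norm_of_nonneg (inv_nonneg.mpr hα0.le)]
        exact mul_le_of_le_one_right (inv_nonneg.mpr hα0.le)
          (abs_expGen_besselCoeff_le_one (by linarith) hx))
      (Set.mem_Ici.mpr le_rfl) (Set.mem_Ici.mpr (abs_nonneg t))
    simpa [expGen_zero, besselCoeff_zero (show -1 < 2 * α - 1 by linarith)] using h
  have hF2 : |t * expGen (fun k => besselCoeff (2 * α - 1) (k + 2)) (|t|)| ≤
      Real.Gamma (2 * α - 1 + 1) / Real.Gamma (2 * α - 1 + 3) * |t| := by
    rw [expGen_besselCoeff_shift_two (by linarith), abs_mul, abs_mul, abs_of_pos hc, mul_comm]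
    exact mul_le_mul_of_nonneg_right (mul_le_of_le_one_right hc.le
      (abs_expGen_besselCoeff_le_one (by linarith) (abs_nonneg t))) (abs_nonneg t)
  rw [deformedHankelKernel_eq hα, add_mul]
  rw [abs_le] at *
  constructor <;> linarith

lemma lintegral_Ioc_two_div_cube {a b : ℝ} (ha : 0 < a) (hab : a ≤ b) :
    ∫⁻ x in Set.Ioc a b, ENNReal.ofReal (2 / x ^ 3) = ENNReal.ofReal (1 / a ^ 2 - 1 / b ^ 2) := by
  have hpos : ∀ x ∈ Set.uIcc a b, x ≠ 0 := fun x hx => by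
    rw [Set.uIcc_of_le hab] at hx
    exact (ha.trans_le hx.1).ne'
  have hcont : ContinuousOn (fun x : ℝ => 2 / x ^ 3) (Set.uIcc a b) :=
    continuousOn_const.div (continuousOn_pow 3) fun x hx => pow_ne_zero 3 (hpos x hx)
  have hI : IntervalIntegrable (fun x : ℝ => 2 / x ^ 3) volume a b := hcont.intervalIntegrable
  have hd : ∀ x ∈ Set.uIcc a b, HasDerivAt (fun x : ℝ => -(1 / x ^ 2)) (2 / x ^ 3) x := by
    intro x hx
    have hx0 := hpos x hx
    have h := ((hasDerivAt_const x (1 : ℝ)).fun_div (hasDerivAt_pow 2 x)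
      (pow_ne_zero 2 hx0)).fun_neg
    refine h.congr_deriv ?_
    push_cast
    field_simp
    ring
  rw [← ofReal_integral_eq_lintegral_ofReal, ← intervalIntegral.integral_of_le hab,
    intervalIntegral.integral_eq_sub_of_hasDerivAt hd hI]
  · congr 1
    ring
  · exact (intervalIntegrable_iff_integrableOn_Ioc_of_le hab).mp hI
  · filter_upwards [ae_restrict_mem measurableSet_Ioc] with x hx
    have := ha.trans hx.1
    simp only [Pi.zero_apply]
    positivity

/-- Layer-cake estimate for the second moment of `μ` over a bounded interval. -/
lemma setLIntegral_sq_le (μ : Measure ℝ) [SFinite μ] {h r : ℝ} (hh : 0 < h) (hr : 0 < r) :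
    ∫⁻ l in {l : ℝ | 1 / h ≤ |l|}ᶜ, ENNReal.ofReal (l ^ 2) ∂μ ≤
      ENNReal.ofReal (1 / r ^ 2) * μ Set.univ +
        ∫⁻ x in Set.Ioc h r, ENNReal.ofReal (2 / x ^ 3) * μ {l : ℝ | 1 / x ≤ |l|} := by
  have hm : Measurable fun p : ℝ × ℝ =>
      ENNReal.ofReal (2 / p.2 ^ 3) * {p : ℝ × ℝ | 1 / p.2 ≤ |p.1|}.indicator 1 p := by
    have hs : MeasurableSet {p : ℝ × ℝ | 1 / p.2 ≤ |p.1|} :=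
      measurableSet_le (by fun_prop) (by fun_prop)
    exact Measurable.mul (by fun_prop) (measurable_one.indicator hs)
  have hA : MeasurableSet {l : ℝ | 1 / h ≤ |l|} := measurableSet_le (by fun_prop) (by fun_prop)
  calc ∫⁻ l in {l : ℝ | 1 / h ≤ |l|}ᶜ, ENNReal.ofReal (l ^ 2) ∂μ
      ≤ ∫⁻ l in {l : ℝ | 1 / h ≤ |l|}ᶜ, (ENNReal.ofReal (1 / r ^ 2) + ∫⁻ x in Set.Ioc h r,
          ENNReal.ofReal (2 / x ^ 3) * {p : ℝ × ℝ | 1 / p.2 ≤ |p.1|}.indicator 1 (l, x)) ∂μ := by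
        refine setLIntegral_mono' hA.compl fun l hl => ?_
        simp only [Set.mem_compl_iff, Set.mem_ofPred_eq, not_le] at hl
        rcases le_or_gt |l| (1 / r) with hlr | hlr
        · refine le_add_right (ENNReal.ofReal_le_ofReal ?_)
          rw [← sq_abs, ← one_div_pow]
          gcongr
        · have hl0 : 0 < |l| := (one_div_pos.mpr hr).trans hlr
          have ha0 : 0 < 1 / |l| := one_div_pos.mpr hl0
          have har : 1 / |l| < r := (one_div_lt hl0 hr).mpr hlr
          have hha : h < 1 / |l| := (lt_one_div hh hl0).mpr hl
          have e : ENNReal.ofReal (l ^ 2) = ENNReal.ofReal (1 / r ^ 2) +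
              ENNReal.ofReal (1 / (1 / |l|) ^ 2 - 1 / r ^ 2) := by
            rw [← ENNReal.ofReal_add (by positivity)]
            · congr 1
              rw [one_div_pow, one_div_one_div, sq_abs]
              ring
            · exact sub_nonneg.mpr (one_div_le_one_div_of_le (by positivity) (by gcongr))
          rw [e, ← lintegral_Ioc_two_div_cube ha0 har.le]
          gcongr 1
          calc ∫⁻ x in Set.Ioc (1 / |l|) r, ENNReal.ofReal (2 / x ^ 3)
              = ∫⁻ x in Set.Ioc (1 / |l|) r, ENNReal.ofReal (2 / x ^ 3) *
                  {p : ℝ × ℝ | 1 / p.2 ≤ |p.1|}.indicator 1 (l, x) := by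
                refine setLIntegral_congr_fun measurableSet_Ioc fun x hx => ?_
                have hx' : 1 / x ≤ |l| := (one_div_le (ha0.trans hx.1) hl0).mpr hx.1.le
                rw [Set.indicator_of_mem (show (l, x) ∈ {p : ℝ × ℝ | 1 / p.2 ≤ |p.1|} from hx'),
                  Pi.one_apply, mul_one]
            _ ≤ _ := lintegral_mono_set (Set.Ioc_subset_Ioc_left hha.le)
    _ ≤ ∫⁻ l, (ENNReal.ofReal (1 / r ^ 2) + ∫⁻ x in Set.Ioc h r,
          ENNReal.ofReal (2 / x ^ 3) * {p : ℝ × ℝ | 1 / p.2 ≤ |p.1|}.indicator 1 (l, x)) ∂μ :=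
        setLIntegral_le_lintegral _ _
    _ = _ := by
        rw [lintegral_add_left measurable_const, lintegral_const,
          lintegral_lintegral_swap hm.aemeasurable]
        congr 1
        refine lintegral_congr fun x => ?_
        have hx : MeasurableSet {l : ℝ | 1 / x ≤ |l|} :=
          measurableSet_le (by fun_prop) (by fun_prop)
        rw [← lintegral_indicator_one hx, ← lintegral_const_mul _ (measurable_one.indicator hx)]
        rfl

/-- The Zygmund condition (Z2) controls the square integral of a modulus of continuity. -/
lemma exists_lintegral_sq_modulus_le {δ0 : ℝ} {ω : ℝ → ℝ} (hω : IsModulusOfContinuity δ0 ω)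
    (hZ2 : ∃ C : ℝ, 0 < C ∧ ∀ t : ℝ, 0 < t → t ≤ δ0 →
      (∫ x in t..δ0, ω x / x ^ 2) ≤ C * (ω t / t)) :
    ∃ C : ℝ, 0 ≤ C ∧ ∀ h, 0 < h → h ≤ δ0 →
      ∫⁻ x in Set.Ioc h δ0, ENNReal.ofReal (2 / x ^ 3) * ENNReal.ofReal (ω x ^ 2) ≤
        ENNReal.ofReal (C * (ω h / h) ^ 2) := by
  obtain ⟨-, hcont, hnonneg, -, C₁, hC₁, hdec⟩ := hω
  obtain ⟨C₂, hC₂, hZ⟩ := hZ2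
  refine ⟨2 * C₁ * C₂, by positivity, fun h hh hhδ => ?_⟩
  have hω0 : 0 ≤ ω h / h := div_nonneg (hnonneg h ⟨hh.le, hhδ⟩) hh.le
  have hI : IntegrableOn (fun x => ω x / x ^ 2) (Set.Ioc h δ0) := by
    refine IntegrableOn.mono_set ?_ Set.Ioc_subset_Icc_self
    exact ((hcont.mono (Set.Icc_subset_Icc_left hh.le)).div (continuousOn_pow 2) fun x hx =>
      pow_ne_zero 2 (hh.trans_le hx.1).ne').integrableOn_Icc
  calc ∫⁻ x in Set.Ioc h δ0, ENNReal.ofReal (2 / x ^ 3) * ENNReal.ofReal (ω x ^ 2)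
      ≤ ∫⁻ x in Set.Ioc h δ0, ENNReal.ofReal (2 * C₁ * (ω h / h) * (ω x / x ^ 2)) := by
        refine setLIntegral_mono' measurableSet_Ioc fun x hx => ?_
        have hx0 : 0 < x := hh.trans hx.1
        have hωx : 0 ≤ ω x := hnonneg x ⟨hx0.le, hx.2⟩
        rw [← ENNReal.ofReal_mul (by positivity)]
        refine ENNReal.ofReal_le_ofReal ?_
        calc 2 / x ^ 3 * ω x ^ 2 = 2 * (ω x / x) * (ω x / x ^ 2) := by field_simp
          _ ≤ 2 * (C₁ * (ω h / h)) * (ω x / x ^ 2) := by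
            gcongr
            exact hdec h x hh hx.1.le hx.2
          _ = _ := by ring
    _ = ENNReal.ofReal (∫ x in Set.Ioc h δ0, 2 * C₁ * (ω h / h) * (ω x / x ^ 2)) := by
        rw [ofReal_integral_eq_lintegral_ofReal (hI.const_mul _)]
        filter_upwards [ae_restrict_mem measurableSet_Ioc] with x hx
        have hωx : 0 ≤ ω x := hnonneg x ⟨(hh.trans hx.1).le, hx.2⟩
        simp only [Pi.zero_apply]
        positivity
    _ ≤ _ := by
        refine ENNReal.ofReal_le_ofReal ?_
        rw [integral_const_mul, ← intervalIntegral.integral_of_le hhδ]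
        calc _ ≤ 2 * C₁ * (ω h / h) * (C₂ * (ω h / h)) := by
              gcongr
              exact hZ h hh hhδ
          _ = _ := by ring

/-- A kernel bounded by `4` and by `K |t|` has weighted square integral of order `ω h ^ 2`
against a finite measure whose tails are of order `ω h ^ 2`. -/
lemma exists_lintegral_kernel_le {δ0 : ℝ} (hδ0 : 0 < δ0) {ω : ℝ → ℝ}
    (hω : IsModulusOfContinuity δ0 ω) (hωpos : ∀ t : ℝ, 0 < t → t ≤ δ0 → 0 < ω t)
    (hZ2 : ∃ C : ℝ, 0 < C ∧ ∀ t : ℝ, 0 < t → t ≤ δ0 →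
      (∫ x in t..δ0, ω x / x ^ 2) ≤ C * (ω t / t))
    (μ : Measure ℝ) [IsFiniteMeasure μ] {C r : ℝ} (hC : 0 < C) (hr : 0 < r) (hrδ : r ≤ δ0)
    (hμ : ∀ h, 0 < h → h ≤ r → μ {l : ℝ | 1 / h ≤ |l|} ≤ ENNReal.ofReal (C * ω h ^ 2))
    {k : ℝ → ℝ} {M K : ℝ} (hM : 0 < M) (hkM : ∀ t, |k t| ≤ M) (hkK : ∀ t, |k t| ≤ K * |t|) :
    ∃ C' : ℝ, 0 < C' ∧ ∀ h, 0 < h → h ≤ r →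
      ∫⁻ l, ENNReal.ofReal (|k (l * h)| ^ 2) ∂μ ≤ ENNReal.ofReal (C' * ω h ^ 2) := by
  obtain ⟨C₂, hC₂, hsq⟩ := exists_lintegral_sq_modulus_le hω hZ2
  obtain ⟨-, -, -, -, C₁, hC₁, hdec⟩ := hω
  set m := μ.real Set.univ with hm
  have hm0 : 0 ≤ m := measureReal_nonneg
  have hωδ := hωpos δ0 hδ0 le_rfl
  set D : ℝ := 1 / r ^ 2 * m * (C₁ * δ0 / ω δ0) ^ 2 with hD
  have hD0 : 0 ≤ D := by positivity
  refine ⟨M ^ 2 * C + K ^ 2 * (D + C * C₂), by positivity, fun h hh hhr => ?_⟩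
  have hhδ := hhr.trans hrδ
  have hωh := hωpos h hh hhδ
  set A : Set ℝ := {l : ℝ | 1 / h ≤ |l|}
  have hA : MeasurableSet A := measurableSet_le (by fun_prop) (by fun_prop)
  have hout : ∫⁻ l in A, ENNReal.ofReal (|k (l * h)| ^ 2) ∂μ ≤
      ENNReal.ofReal (M ^ 2 * C * ω h ^ 2) := by
    calc _ ≤ ∫⁻ _ in A, ENNReal.ofReal (M ^ 2) ∂μ := by
          refine lintegral_mono fun l => ENNReal.ofReal_le_ofReal ?_
          gcongr
          exact hkM _
      _ ≤ ENNReal.ofReal (M ^ 2) * ENNReal.ofReal (C * ω h ^ 2) := by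
          rw [setLIntegral_const]
          gcongr
          exact hμ h hh hhr
      _ = _ := by rw [← ENNReal.ofReal_mul (by positivity), mul_assoc]
  have hmass : 1 / r ^ 2 * m ≤ D * (ω h / h) ^ 2 := by
    have h1 : 1 ≤ C₁ * δ0 / ω δ0 * (ω h / h) := by
      have := hdec h δ0 hh hhδ le_rfl
      rw [div_le_iff₀ hδ0] at this
      rw [div_mul_eq_mul_div, one_le_div hωδ]
      linarith
    calc 1 / r ^ 2 * m ≤ 1 / r ^ 2 * m * (C₁ * δ0 / ω δ0 * (ω h / h)) ^ 2 :=
          le_mul_of_one_le_right (by positivity) (one_le_pow₀ h1)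
      _ = _ := by rw [hD]; ring
  have hlayer : ∫⁻ x in Set.Ioc h r, ENNReal.ofReal (2 / x ^ 3) * μ {l : ℝ | 1 / x ≤ |l|} ≤
      ENNReal.ofReal (C * (C₂ * (ω h / h) ^ 2)) := by
    calc _ ≤ ∫⁻ x in Set.Ioc h r, ENNReal.ofReal C *
            (ENNReal.ofReal (2 / x ^ 3) * ENNReal.ofReal (ω x ^ 2)) := by
          refine setLIntegral_mono' measurableSet_Ioc fun x hx => ?_
          rw [mul_left_comm, ← ENNReal.ofReal_mul hC.le]
          gcongr
          exact hμ x (hh.trans hx.1) hx.2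
      _ ≤ ∫⁻ x in Set.Ioc h δ0, ENNReal.ofReal C *
            (ENNReal.ofReal (2 / x ^ 3) * ENNReal.ofReal (ω x ^ 2)) :=
          lintegral_mono_set (Set.Ioc_subset_Ioc_right hrδ)
      _ ≤ _ := by
          rw [lintegral_const_mul' _ _ ENNReal.ofReal_ne_top, ENNReal.ofReal_mul hC.le]
          gcongr
          exact hsq h hh hhδ
  have hin : ∫⁻ l in Aᶜ, ENNReal.ofReal (|k (l * h)| ^ 2) ∂μ ≤
      ENNReal.ofReal (K ^ 2 * (D + C * C₂) * ω h ^ 2) := by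
    calc _ ≤ ∫⁻ l in Aᶜ, ENNReal.ofReal (K ^ 2 * h ^ 2) * ENNReal.ofReal (l ^ 2) ∂μ := by
          refine lintegral_mono fun l => ?_
          simp only
          rw [← ENNReal.ofReal_mul (by positivity)]
          refine ENNReal.ofReal_le_ofReal ?_
          calc |k (l * h)| ^ 2 ≤ (K * |l * h|) ^ 2 := by
                gcongr
                exact hkK _
            _ = K ^ 2 * h ^ 2 * l ^ 2 := by rw [mul_pow, sq_abs]; ring
      _ ≤ ENNReal.ofReal (K ^ 2 * h ^ 2) * (ENNReal.ofReal (1 / r ^ 2) * μ Set.univ +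
            ∫⁻ x in Set.Ioc h r, ENNReal.ofReal (2 / x ^ 3) * μ {l : ℝ | 1 / x ≤ |l|}) := by
          rw [lintegral_const_mul' _ _ ENNReal.ofReal_ne_top]
          gcongr
          exact setLIntegral_sq_le μ hh hr
      _ ≤ ENNReal.ofReal (K ^ 2 * h ^ 2) * (ENNReal.ofReal (D * (ω h / h) ^ 2) +
            ENNReal.ofReal (C * (C₂ * (ω h / h) ^ 2))) := by
          rw [← ofReal_measureReal, ← ENNReal.ofReal_mul (by positivity)]
          gcongr
      _ = _ := by
          rw [← ENNReal.ofReal_add (by positivity) (by positivity),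
            ← ENNReal.ofReal_mul (by positivity)]
          congr 1
          field_simp
  rw [← lintegral_add_compl _ hA]
  refine (add_le_add hout hin).trans_eq ?_
  rw [← ENNReal.ofReal_add (by positivity) (by positivity), add_mul]

/-- An exterior `L²` bound by `ω(h)²`, for `ω` satisfying the Zygmund condition
(Z2) and suitable conditions at infinity, implies the bound
`∫ |1 - B_α(λh)|² |g(λ)|² |λ|^{2α-1} dλ ≤ C' ω(h)²` for all small `h > 0`. -/
theorem exterior_bound_to_kernel_bound
    (δ0 : ℝ) (hδ0 : 0 < δ0) (α : ℝ) (hα : 1 / 4 < α)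
    (ω : ℝ → ℝ) (hω : IsModulusOfContinuity δ0 ω)
    (hωpos : ∀ t : ℝ, 0 < t → t ≤ δ0 → 0 < ω t)
    (hbelow : ∃ c : ℝ, 0 < c ∧ ∀ t : ℝ, δ0 ≤ t → c ≤ ω t)
    (hZ2 : ∃ C : ℝ, 0 < C ∧ ∀ t : ℝ, 0 < t → t ≤ δ0 →
      (∫ x in t..δ0, ω x / x ^ 2) ≤ C * (ω t / t))
    (hint : MeasureTheory.IntegrableOn (fun t => ω t ^ 2 / t ^ 3) (Set.Ici δ0))
    (g : ℝ → ℂ) (hg : Measurable g)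
    (hg2 : MeasureTheory.Integrable (fun l : ℝ => ‖g l‖ ^ 2 * |l| ^ (2 * α - 1)))
    (C : ℝ) (hC : 0 < C)
    (hyp : ∃ h₁ : ℝ, 0 < h₁ ∧ ∀ h : ℝ, 0 < h → h ≤ h₁ →
      (∫ l in {l : ℝ | 1 / h ≤ |l|}, ‖g l‖ ^ 2 * |l| ^ (2 * α - 1)) ≤ C * ω h ^ 2) :
    ∃ C' h₂ : ℝ, 0 < C' ∧ 0 < h₂ ∧ ∀ h : ℝ, 0 < h → h ≤ h₂ →
      (∫ l : ℝ, |1 - deformedHankelKernel α (l * h)| ^ 2 * ‖g l‖ ^ 2 * |l| ^ (2 * α - 1))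
        ≤ C' * ω h ^ 2 := by
  obtain ⟨h₁, hh₁, hyp⟩ := hyp
  obtain ⟨K, -, hK⟩ := exists_abs_one_sub_deformedHankelKernel_le hα
  have hdens : ∀ l : ℝ, 0 ≤ ‖g l‖ ^ 2 * |l| ^ (2 * α - 1) := fun l => by positivity
  set μ : Measure ℝ :=
    volume.withDensity fun l => ENNReal.ofReal (‖g l‖ ^ 2 * |l| ^ (2 * α - 1)) with hμ
  have hmeas : Measurable fun l : ℝ => ENNReal.ofReal (‖g l‖ ^ 2 * |l| ^ (2 * α - 1)) := by
    fun_prop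
  have : IsFiniteMeasure μ := isFiniteMeasure_withDensity_ofReal hg2.2
  have htail : ∀ h, 0 < h → h ≤ min h₁ δ0 →
      μ {l : ℝ | 1 / h ≤ |l|} ≤ ENNReal.ofReal (C * ω h ^ 2) := by
    intro h hh hhr
    rw [hμ, withDensity_apply _ (measurableSet_le (by fun_prop) (by fun_prop)),
      ← ofReal_integral_eq_lintegral_ofReal hg2.integrableOn (ae_of_all _ hdens)]
    exact ENNReal.ofReal_le_ofReal (hyp h hh (hhr.trans (min_le_left _ _)))
  obtain ⟨C', hC', hbound⟩ := exists_lintegral_kernel_le hδ0 hω hωpos hZ2 μ hC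
    (lt_min hh₁ hδ0) (min_le_right _ _) htail (k := fun t => 1 - deformedHankelKernel α t)
    four_pos (abs_one_sub_deformedHankelKernel_le_four hα) hK
  refine ⟨C', min h₁ δ0, hC', lt_min hh₁ hδ0, fun h hh hhr => ?_⟩
  refine (Real.le_norm_self _).trans ?_
  rw [← ENNReal.ofReal_le_ofReal_iff (by positivity), ofReal_norm]
  refine (enorm_integral_le_lintegral_enorm _).trans (le_trans (le_of_eq ?_) (hbound h hh hhr))
  rw [hμ, lintegral_withDensity_eq_lintegral_mul_non_measurable _ hmeas
    (ae_of_all _ fun _ => ENNReal.ofReal_lt_top)]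
  refine lintegral_congr fun l => ?_
  rw [Pi.mul_apply, ← ENNReal.ofReal_mul (hdens l), Real.enorm_of_nonneg (by positivity)]
  congr 1
  ring
end

section
/- Let α > 1/4, let q ∈ [2, ∞) and 0 < ν ≤ q, and let ω be a modulus of continuity on [0, 1]. Assume the two conditions: t ↦ ω(t)^ν / t^{2α(1−ν/q)+1} is integrable on (0, 1], and limsup_{h→0+} ω(h)^ν / h^{2α(1−ν/q)} < ∞. Let g : ℝ → ℂ be measurable with ∫_ℝ |g(λ)|^q |λ|^{2α−1} dλ < ∞, and suppose there exist C > 0 and y₀ ≥ 1 such that for all y ≥ y₀, ∫_{|λ| < y} |λ|^q |g(λ)|^q |λ|^{2α−1} dλ ≤ C y^q ω(1/y)^q. Then ∫_ℝ |g(λ)|^ν |λ|^{2α−1} dλ < ∞. -/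
open MeasureTheory Filter Topology

theorem Real.rpow_le_rpow_add_rpow_mul_rpow {x a ν q : ℝ} (hx : 0 ≤ x) (ha : 0 < a)
    (hν : 0 ≤ ν) (hνq : ν ≤ q) : x ^ ν ≤ a ^ ν + a ^ (ν - q) * x ^ q := by
  rcases le_or_gt x a with h | h
  · have h1 := Real.rpow_le_rpow hx h hν
    have h2 : 0 ≤ a ^ (ν - q) * x ^ q := by positivity
    linarith
  · have hx0 : 0 < x := ha.trans h
    have h1 : x ^ ν = x ^ (ν - q) * x ^ q := by
      rw [← Real.rpow_add hx0]; ring_nf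
    have h2 : x ^ (ν - q) ≤ a ^ (ν - q) :=
      Real.rpow_le_rpow_of_nonpos ha h.le (by linarith)
    have h3 : x ^ (ν - q) * x ^ q ≤ a ^ (ν - q) * x ^ q := by gcongr
    have h4 : 0 ≤ a ^ ν := by positivity
    linarith

theorem integrableOn_abs_rpow_setOf_abs_lt {p : ℝ} (hp : -1 < p) (r : ℝ) :
    IntegrableOn (fun l : ℝ => |l| ^ p) {l : ℝ | |l| < r} := by
  have h := integrableOn_ball_of_norm_le_rpow (μ := (volume : Measure ℝ))
    (f := fun l : ℝ => |l| ^ p) (C := 1) (α := -p) (r := r) (by simp) (by simp; linarith)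
    (ae_of_all _ fun x => by
      simp [abs_of_nonneg (Real.rpow_nonneg (abs_nonneg x) p)])
    (Measurable.aestronglyMeasurable (by fun_prop))
  refine h.mono_set fun x hx => ?_
  simpa using hx

/-- The symmetric shell `r ≤ |l| < 2 r`. -/
def absShell (r : ℝ) : Set ℝ := {l : ℝ | r ≤ |l| ∧ |l| < 2 * r}

theorem measurableSet_absShell (r : ℝ) : MeasurableSet (absShell r) :=
  (measurableSet_le measurable_const measurable_id.abs : MeasurableSet {l : ℝ | r ≤ |l|}).inter
    (measurableSet_lt measurable_id.abs measurable_const : MeasurableSet {l : ℝ | |l| < 2 * r})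

theorem absShell_subset (r : ℝ) : absShell r ⊆ {l : ℝ | |l| < 2 * r} := fun _ h => h.2

theorem measurableSet_setOf_abs_lt (r : ℝ) : MeasurableSet {l : ℝ | |l| < r} :=
  measurableSet_lt (by fun_prop) measurable_const

theorem setIntegral_absShell_abs_rpow_le {p r : ℝ} (hr : 0 < r) :
    ∫ l in absShell r, |l| ^ p ≤ 4 * 2 ^ |p| * r ^ (p + 1) := by
  have hsub : absShell r ⊆ Set.Ioo (-(2 * r)) (2 * r) := fun l h => abs_lt.mp h.2
  have hvol : volume (absShell r) < ⊤ := (measure_mono hsub).trans_lt (by simp)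
  have hreal : volume.real (absShell r) ≤ 4 * r := by
    refine (measureReal_mono hsub (by simp)).trans (le_of_eq ?_)
    rw [Real.volume_real_Ioo_of_le (by linarith)]; ring
  have hb : ∀ l ∈ absShell r, ‖|l| ^ p‖ ≤ 2 ^ |p| * r ^ p := by
    intro l hl
    have hl0 : 0 < |l| := hr.trans_le hl.1
    rw [Real.norm_of_nonneg (by positivity)]
    have hdiv : |l| = |l| / r * r := by field_simp
    rw [hdiv, Real.mul_rpow (by positivity) hr.le]
    have h1 : 1 ≤ |l| / r := by rw [le_div_iff₀ hr]; linarith [hl.1]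
    have h2 : |l| / r ≤ 2 := by rw [div_le_iff₀ hr]; exact hl.2.le
    gcongr
    calc (|l| / r) ^ p ≤ (|l| / r) ^ |p| := Real.rpow_le_rpow_of_exponent_le h1 (le_abs_self p)
      _ ≤ 2 ^ |p| := by gcongr
  have h := norm_setIntegral_le_of_norm_le_const hvol hb
  calc ∫ l in absShell r, |l| ^ p ≤ ‖∫ l in absShell r, |l| ^ p‖ := Real.le_norm_self _
    _ ≤ 2 ^ |p| * r ^ p * volume.real (absShell r) := h
    _ ≤ 2 ^ |p| * r ^ p * (4 * r) := by gcongr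
    _ = 4 * 2 ^ |p| * r ^ (p + 1) := by rw [Real.rpow_add_one hr.ne']; ring

theorem integrableOn_norm_rpow_mul_of_le {g : ℝ → ℂ} (hg : Measurable g) {ν q p : ℝ}
    (hν : 0 ≤ ν) (hνq : ν ≤ q) (hp : -1 < p)
    (hgq : Integrable (fun l : ℝ => ‖g l‖ ^ q * |l| ^ p)) (r : ℝ) :
    IntegrableOn (fun l : ℝ => ‖g l‖ ^ ν * |l| ^ p) {l : ℝ | |l| < r} := by
  refine Integrable.mono' ((integrableOn_abs_rpow_setOf_abs_lt hp r).add hgq.integrableOn)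
    (by fun_prop) (ae_of_all _ fun l => ?_)
  rw [Real.norm_of_nonneg (by positivity)]
  have h := Real.rpow_le_rpow_add_rpow_mul_rpow (norm_nonneg (g l)) one_pos hν hνq
  simp only [Real.one_rpow, one_mul] at h
  calc ‖g l‖ ^ ν * |l| ^ p ≤ (1 + ‖g l‖ ^ q) * |l| ^ p := by gcongr
    _ = _ := by simp; ring

theorem setIntegral_absShell_norm_rpow_le_of_le {g : ℝ → ℂ} (hg : Measurable g) {ν q p r B M s : ℝ}
    (hν : 0 < ν) (hνq : ν ≤ q) (hp : -1 < p) (hr : 0 < r) (hs : 0 ≤ s)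
    (hgq : Integrable (fun l : ℝ => ‖g l‖ ^ q * |l| ^ p))
    (hB : ∫ l in absShell r, |l| ^ p ≤ B * r ^ (p + 1))
    (hM : ∫ l in absShell r, ‖g l‖ ^ q * |l| ^ p ≤ M * s ^ q) (hM0 : 0 ≤ M) :
    ∫ l in absShell r, ‖g l‖ ^ ν * |l| ^ p ≤ (B + M) * (s ^ ν * r ^ ((p + 1) * (1 - ν / q))) := by
  have hq : 0 < q := hν.trans_le hνq
  have hw := (integrableOn_abs_rpow_setOf_abs_lt hp (2 * r)).mono_set (absShell_subset r)
  have hgν := (integrableOn_norm_rpow_mul_of_le hg hν.le hνq hp hgq (2 * r)).mono_set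
    (absShell_subset r)
  have key : ∀ u : ℝ, s < u → ∫ l in absShell r, ‖g l‖ ^ ν * |l| ^ p ≤
      (B + M) * (u ^ ν * r ^ ((p + 1) * (1 - ν / q))) := by
    intro u hu
    have hu0 : 0 < u := hs.trans_lt hu
    set a : ℝ := u * r ^ (-((p + 1) / q)) with ha_def
    have ha : 0 < a := by positivity
    have hI : ∫ l in absShell r, ‖g l‖ ^ ν * |l| ^ p ≤
        a ^ ν * (∫ l in absShell r, |l| ^ p) +
          a ^ (ν - q) * ∫ l in absShell r, ‖g l‖ ^ q * |l| ^ p := by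
      rw [← integral_const_mul, ← integral_const_mul,
        ← integral_add (hw.const_mul _) (hgq.integrableOn.const_mul _)]
      refine setIntegral_mono_on hgν ((hw.const_mul _).add (hgq.integrableOn.const_mul _))
        (measurableSet_absShell r) fun l _ => ?_
      have h := Real.rpow_le_rpow_add_rpow_mul_rpow (norm_nonneg (g l)) ha hν.le hνq
      calc ‖g l‖ ^ ν * |l| ^ p ≤ (a ^ ν + a ^ (ν - q) * ‖g l‖ ^ q) * |l| ^ p := by gcongr
        _ = _ := by ring
    have hM' : ∫ l in absShell r, ‖g l‖ ^ q * |l| ^ p ≤ M * u ^ q :=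
      hM.trans (by gcongr)
    have e1 : a ^ ν * r ^ (p + 1) = u ^ ν * r ^ ((p + 1) * (1 - ν / q)) := by
      rw [ha_def, Real.mul_rpow hu0.le (by positivity), ← Real.rpow_mul hr.le, mul_assoc,
        ← Real.rpow_add hr]
      congr 2; field_simp; ring
    have e2 : a ^ (ν - q) * u ^ q = u ^ ν * r ^ ((p + 1) * (1 - ν / q)) := by
      rw [ha_def, Real.mul_rpow hu0.le (by positivity), ← Real.rpow_mul hr.le, mul_right_comm,
        ← Real.rpow_add hu0]
      congr 2
      · ring
      · field_simp; ring
    calc ∫ l in absShell r, ‖g l‖ ^ ν * |l| ^ p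
        ≤ a ^ ν * (∫ l in absShell r, |l| ^ p) +
          a ^ (ν - q) * ∫ l in absShell r, ‖g l‖ ^ q * |l| ^ p := hI
      _ ≤ a ^ ν * (B * r ^ (p + 1)) + a ^ (ν - q) * (M * u ^ q) := by gcongr
      _ = B * (a ^ ν * r ^ (p + 1)) + M * (a ^ (ν - q) * u ^ q) := by ring
      _ = _ := by rw [e1, e2]; ring
  have hcont : Tendsto (fun u : ℝ => (B + M) * (u ^ ν * r ^ ((p + 1) * (1 - ν / q))))
      (𝓝[>] s) (𝓝 ((B + M) * (s ^ ν * r ^ ((p + 1) * (1 - ν / q))))) := by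
    refine Tendsto.mono_left ?_ nhdsWithin_le_nhds
    exact (((Real.continuousAt_rpow_const s ν (Or.inr hν.le)).tendsto).mul_const _).const_mul _
  exact ge_of_tendsto hcont (eventually_mem_nhdsWithin.mono key)

theorem setIntegral_absShell_le_of_weighted_bound {g : ℝ → ℂ} {q p r D : ℝ} (hg : Measurable g)
    (hq : 0 ≤ q) (hr : 0 < r) (hgq : Integrable (fun l : ℝ => ‖g l‖ ^ q * |l| ^ p))
    (hD : ∫ l in {l : ℝ | |l| < 2 * r}, |l| ^ q * ‖g l‖ ^ q * |l| ^ p ≤ (2 * r) ^ q * D) :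
    ∫ l in absShell r, ‖g l‖ ^ q * |l| ^ p ≤ 2 ^ q * D := by
  have hint : IntegrableOn (fun l : ℝ => |l| ^ q * ‖g l‖ ^ q * |l| ^ p)
      {l : ℝ | |l| < 2 * r} := by
    refine Integrable.mono' (hgq.integrableOn.const_mul ((2 * r) ^ q)) (by fun_prop) ?_
    filter_upwards [ae_restrict_mem (measurableSet_setOf_abs_lt (2 * r))] with l hl
    rw [Real.norm_of_nonneg (by positivity), mul_assoc]
    have hl' : |l| ≤ 2 * r := le_of_lt hl
    gcongr
  have h1 : r ^ q * ∫ l in absShell r, ‖g l‖ ^ q * |l| ^ p ≤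
      ∫ l in absShell r, |l| ^ q * ‖g l‖ ^ q * |l| ^ p := by
    rw [← integral_const_mul]
    refine setIntegral_mono_on (hgq.integrableOn.const_mul _) (hint.mono_set (absShell_subset r))
      (measurableSet_absShell r) fun l hl => ?_
    rw [mul_assoc]
    have := hl.1
    gcongr
  have h2 : ∫ l in absShell r, |l| ^ q * ‖g l‖ ^ q * |l| ^ p ≤
      ∫ l in {l : ℝ | |l| < 2 * r}, |l| ^ q * ‖g l‖ ^ q * |l| ^ p :=
    setIntegral_mono_set hint (ae_of_all _ fun l => by simp only [Pi.zero_apply]; positivity)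
      (absShell_subset r).eventuallyLE
  have h3 := (h1.trans h2).trans hD
  rw [Real.mul_rpow zero_le_two hr.le, mul_comm ((2 : ℝ) ^ q), mul_assoc] at h3
  exact le_of_mul_le_mul_left h3 (by positivity)

theorem rpow_mul_rpow_le_setIntegral_of_almost_increasing {ω : ℝ → ℝ} {K ν β r : ℝ}
    (hω0 : ∀ t ∈ Set.Icc (0 : ℝ) 1, 0 ≤ ω t) (hK : 1 ≤ K)
    (hKω : ∀ t s : ℝ, 0 ≤ t → t ≤ s → s ≤ 1 → ω t ≤ K * ω s) (hν : 0 ≤ ν) (hβ : 0 ≤ β)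
    (hint : IntegrableOn (fun t => ω t ^ ν / t ^ (β + 1)) (Set.Ioc (0 : ℝ) 1)) (hr : 1 ≤ r) :
    ω (1 / (2 * r)) ^ ν * r ^ β ≤
      2 * K ^ ν * ∫ t in Set.Ioc (1 / (2 * r)) (1 / r), ω t ^ ν / t ^ (β + 1) := by
  have hr0 : 0 < r := by linarith
  have hr1 : 1 / r ≤ 1 := by rw [div_le_one hr0]; exact hr
  have hlow : 0 < 1 / (2 * r) := by positivity
  have hle : 1 / (2 * r) ≤ 1 / r := by gcongr; linarith
  have hsub : Set.Ioc (1 / (2 * r)) (1 / r) ⊆ Set.Ioc (0 : ℝ) 1 :=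
    Set.Ioc_subset_Ioc hlow.le hr1
  have hωr := hω0 (1 / (2 * r)) ⟨hlow.le, hle.trans hr1⟩
  have hmono : ∫ _ in Set.Ioc (1 / (2 * r)) (1 / r), ω (1 / (2 * r)) ^ ν * r ^ (β + 1) ≤
      ∫ t in Set.Ioc (1 / (2 * r)) (1 / r), K ^ ν * (ω t ^ ν / t ^ (β + 1)) := by
    refine setIntegral_mono_on (integrableOn_const (by simp))
      ((hint.mono_set hsub).const_mul _) measurableSet_Ioc fun t ht => ?_
    have ht0 : 0 < t := hlow.trans ht.1
    have hωt := hω0 t ⟨ht0.le, ht.2.trans hr1⟩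
    have h1 : ω (1 / (2 * r)) ^ ν ≤ K ^ ν * ω t ^ ν := by
      rw [← Real.mul_rpow (by linarith) hωt]
      exact Real.rpow_le_rpow hωr (hKω _ _ hlow.le ht.1.le (ht.2.trans hr1)) hν
    have h2 : r ^ (β + 1) ≤ (t ^ (β + 1))⁻¹ := by
      rw [← Real.inv_rpow ht0.le]
      refine Real.rpow_le_rpow hr0.le ?_ (by linarith)
      rw [le_inv_comm₀ hr0 ht0, ← one_div]
      exact ht.2
    calc ω (1 / (2 * r)) ^ ν * r ^ (β + 1) ≤ (K ^ ν * ω t ^ ν) * (t ^ (β + 1))⁻¹ := by gcongr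
      _ = _ := by ring
  rw [setIntegral_const, Real.volume_real_Ioc_of_le hle, integral_const_mul, smul_eq_mul,
    Real.rpow_add_one hr0.ne'] at hmono
  have e : (1 / r - 1 / (2 * r)) * (ω (1 / (2 * r)) ^ ν * (r ^ β * r)) =
      ω (1 / (2 * r)) ^ ν * r ^ β / 2 := by field_simp; ring
  rw [e] at hmono
  linarith

theorem pairwise_disjoint_Ioc_one_div_two_pow {y : ℝ} (hy : 0 < y) :
    Pairwise (Function.onFun Disjoint fun k : ℕ =>
      Set.Ioc (1 / (2 * (y * 2 ^ k))) (1 / (y * 2 ^ k))) := by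
  have h : Antitone fun k : ℕ => 1 / (y * (2 : ℝ) ^ k) := by
    intro i j hij
    dsimp only
    gcongr
    norm_num
  convert h.pairwise_disjoint_on_Ioc_succ using 4
  rw [Nat.succ_eq_succ, Nat.succ_eq_add_one, pow_succ]; ring_nf

theorem setOf_le_abs_subset_iUnion_absShell {y : ℝ} (hy : 0 < y) :
    {l : ℝ | y ≤ |l|} ⊆ ⋃ k : ℕ, absShell (y * 2 ^ k) := by
  intro l hl
  obtain ⟨k, hk1, hk2⟩ := exists_nat_pow_near (x := |l| / y) (y := (2 : ℝ))
    (by rw [le_div_iff₀ hy]; simpa using hl) one_lt_two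
  refine Set.mem_iUnion.mpr ⟨k, ?_, ?_⟩
  · rw [le_div_iff₀ hy] at hk1; linarith
  · rw [div_lt_iff₀ hy, pow_succ] at hk2; linarith

/-- Under the two integrability/boundedness conditions on `ω`, the weighted bound
on `∫_{|λ|<y} |λ|^q |g(λ)|^q |λ|^{2α-1} dλ` implies that
`∫_ℝ |g(λ)|^ν |λ|^{2α-1} dλ` is finite. -/
theorem Lnu_boundedness
    (α : ℝ) (hα : 1 / 4 < α) (q ν : ℝ) (hq : 2 ≤ q) (hν0 : 0 < ν) (hνq : ν ≤ q)
    (ω : ℝ → ℝ) (hω : IsModulusOfContinuity 1 ω)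
    (hcond1 : IntegrableOn (fun t => ω t ^ ν / t ^ (2 * α * (1 - ν / q) + 1))
      (Set.Ioc (0:ℝ) 1))
    (hcond2 : Filter.IsBoundedUnder (· ≤ ·) (nhdsWithin 0 (Set.Ioi 0))
      (fun h : ℝ => ω h ^ ν / h ^ (2 * α * (1 - ν / q))))
    (g : ℝ → ℂ) (hg : Measurable g)
    (hgq : Integrable (fun l : ℝ => ‖g l‖ ^ q * |l| ^ (2 * α - 1)))
    (C : ℝ) (hC : 0 < C) (y₀ : ℝ) (hy₀ : 1 ≤ y₀)
    (hyp : ∀ y : ℝ, y₀ ≤ y →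
      (∫ l in {l : ℝ | |l| < y}, |l| ^ q * ‖g l‖ ^ q * |l| ^ (2 * α - 1))
        ≤ C * (y ^ q * ω (1 / y) ^ q)) :
    Integrable (fun l : ℝ => ‖g l‖ ^ ν * |l| ^ (2 * α - 1)) := by
  obtain ⟨-, -, hω0, ⟨K, hK, hKω⟩, -⟩ := hω
  have hq0 : 0 < q := by linarith
  have hp : -1 < 2 * α - 1 := by linarith
  have hβ : 0 ≤ 2 * α * (1 - ν / q) :=
    mul_nonneg (by linarith) (sub_nonneg.mpr ((div_le_one hq0).mpr hνq))
  have hy0 : 0 < y₀ := by linarith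
  set B : ℝ := 4 * 2 ^ |2 * α - 1|
  set F : ℝ → ℝ := fun t => ω t ^ ν / t ^ (2 * α * (1 - ν / q) + 1)
  have hle : ∀ k : ℕ, y₀ ≤ y₀ * 2 ^ k := fun k =>
    le_mul_of_one_le_right hy0.le (one_le_pow₀ one_le_two)
  have hshell : ∀ k : ℕ, ∫ l in absShell (y₀ * 2 ^ k), ‖g l‖ ^ ν * |l| ^ (2 * α - 1) ≤
      (B + 2 ^ q * C) * (2 * K ^ ν *
        ∫ t in Set.Ioc (1 / (2 * (y₀ * 2 ^ k))) (1 / (y₀ * 2 ^ k)), F t) := by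
    intro k
    have hr1 : 1 ≤ y₀ * 2 ^ k := hy₀.trans (hle k)
    generalize hrk : y₀ * 2 ^ k = r at hr1
    have hyr : y₀ ≤ 2 * r := by linarith [hle k]
    have hr0 : 0 < r := by linarith
    have hωr : 0 ≤ ω (1 / (2 * r)) :=
      hω0 _ ⟨by positivity, (div_le_one (by positivity)).mpr (by linarith)⟩
    have hD := setIntegral_absShell_le_of_weighted_bound hg hq0.le hr0 hgq
      (D := C * ω (1 / (2 * r)) ^ q) ((hyp _ hyr).trans_eq (by ring))
    rw [← mul_assoc] at hD
    have h := setIntegral_absShell_norm_rpow_le_of_le hg hν0 hνq hp hr0 hωr hgq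
      (setIntegral_absShell_abs_rpow_le hr0) hD (by positivity)
    rw [sub_add_cancel] at h
    refine h.trans (mul_le_mul_of_nonneg_left ?_ (by positivity))
    exact rpow_mul_rpow_le_setIntegral_of_almost_increasing hω0 hK hKω hν0.le hβ hcond1 hr1
  have hsum : Summable fun k : ℕ =>
      ∫ t in Set.Ioc (1 / (2 * (y₀ * 2 ^ k))) (1 / (y₀ * 2 ^ k)), F t := by
    refine (hasSum_integral_iUnion (fun _ => measurableSet_Ioc)
      (pairwise_disjoint_Ioc_one_div_two_pow hy0)
      (hcond1.mono_set (Set.iUnion_subset fun k => ?_))).summable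
    have hr1 : 1 ≤ y₀ * 2 ^ k := hy₀.trans (hle k)
    exact Set.Ioc_subset_Ioc (by positivity) ((div_le_one (by positivity)).mpr hr1)
  have hball := integrableOn_norm_rpow_mul_of_le hg hν0.le hνq hp hgq
  have houter : IntegrableOn (fun l : ℝ => ‖g l‖ ^ ν * |l| ^ (2 * α - 1))
      (⋃ k : ℕ, absShell (y₀ * 2 ^ k)) := by
    refine integrableOn_iUnion_of_summable_integral_norm
      (fun k => (hball _).mono_set (absShell_subset _))
      (Summable.of_nonneg_of_le (fun k => integral_nonneg fun l => norm_nonneg _) (fun k => ?_)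
        ((hsum.mul_left (2 * K ^ ν)).mul_left (B + 2 ^ q * C)))
    refine le_of_eq_of_le (integral_congr_ae (ae_of_all _ fun l => ?_)) (hshell k)
    exact Real.norm_of_nonneg (by positivity)
  rw [← integrableOn_univ]
  refine ((hball y₀).union houter).mono_set fun l _ => ?_
  rcases lt_or_ge |l| y₀ with h | h
  · exact Or.inl h
  · exact Or.inr (setOf_le_abs_subset_iUnion_absShell hy0 h)
end

section
/- Let α > 1/4. Then there exist constants C > 0 and δ > 0 such that |B_α(t) − 1| ≥ C |t| for all t ∈ ℝ with |t| ≤ δ. -/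
open MeasureTheory Filter Topology

/-- The power series coefficients of the normalized Bessel function are absolutely summable. -/
theorem summable_abs_besselNorm_coeff {β : ℝ} (hβ : -1 < β) :
    Summable fun k : ℕ => |(-1 : ℝ) ^ k / ((k.factorial : ℝ) * Real.Gamma (k + β + 1))| := by
  refine summable_of_ratio_norm_eventually_le (r := 1 / 2) (by norm_num) ?_
  filter_upwards [eventually_ge_atTop 2] with k hk
  have hk' : (2 : ℝ) ≤ k := by exact_mod_cast hk
  have hpos : 0 < (k : ℝ) + β + 1 := by linarith
  have hG := Real.Gamma_pos_of_pos hpos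
  have hGs : Real.Gamma (((k + 1 : ℕ) : ℝ) + β + 1)
      = (k + β + 1) * Real.Gamma (k + β + 1) := by
    rw [← Real.Gamma_add_one hpos.ne']
    congr 1
    push_cast
    ring
  have hF : (0 : ℝ) < k.factorial := by positivity
  simp only [Real.norm_eq_abs, abs_abs, abs_div, abs_pow, abs_neg, abs_one, one_pow]
  rw [hGs, abs_of_pos (by positivity), abs_of_pos (by positivity), Nat.factorial_succ,
    div_mul_div_comm, one_mul]
  refine one_div_le_one_div_of_le (by positivity) ?_
  push_cast
  have hprod : 2 ≤ ((k : ℝ) + 1) * (k + β + 1) := by nlinarith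
  nlinarith [mul_le_mul_of_nonneg_right hprod (mul_pos hF hG).le]

/-- Second-order Taylor estimate for the normalized Bessel function at the origin. -/
theorem exists_abs_besselNorm_sub_le {β : ℝ} (hβ : -1 < β) :
    ∃ K : ℝ, 0 ≤ K ∧ ∀ s : ℝ, 0 ≤ s → s ≤ 1 →
      |besselNorm β (2 * Real.sqrt s) - (1 - s / (β + 1))| ≤ K * s ^ 2 := by
  set a : ℕ → ℝ := fun k => (-1 : ℝ) ^ k / ((k.factorial : ℝ) * Real.Gamma (k + β + 1)) with ha
  have hsum : Summable fun k => |a k| := summable_abs_besselNorm_coeff hβ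
  have hβ' : 0 < β + 1 := by linarith
  have hG := Real.Gamma_pos_of_pos hβ'
  have htail : Summable fun k => |a (k + 2)| := (summable_nat_add_iff 2).2 hsum
  refine ⟨Real.Gamma (β + 1) * ∑' k, |a (k + 2)|,
    mul_nonneg hG.le (tsum_nonneg fun _ => abs_nonneg _), fun s hs hs1 => ?_⟩
  have hterm : Summable fun k => a k * s ^ k := by
    refine Summable.of_norm_bounded hsum fun k => ?_
    rw [Real.norm_eq_abs, abs_mul, abs_of_nonneg (pow_nonneg hs k)]
    exact mul_le_of_le_one_right (abs_nonneg _) (pow_le_one₀ hs hs1)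
  have hbd : ∀ k, ‖a (k + 2) * s ^ (k + 2)‖ ≤ |a (k + 2)| * s ^ 2 := fun k => by
    rw [Real.norm_eq_abs, abs_mul, abs_of_nonneg (pow_nonneg hs _)]
    exact mul_le_mul_of_nonneg_left (pow_le_pow_of_le_one hs hs1 (by omega)) (abs_nonneg _)
  have hrest : |∑' k, a (k + 2) * s ^ (k + 2)| ≤ (∑' k, |a (k + 2)|) * s ^ 2 := by
    rw [← tsum_mul_right]
    exact tsum_of_norm_bounded (htail.mul_right _).hasSum hbd
  have hbessel : besselNorm β (2 * Real.sqrt s) = Real.Gamma (β + 1) * ∑' k, a k * s ^ k := by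
    simp only [besselNorm, ha, mul_div_cancel_left₀ (Real.sqrt s) (two_ne_zero' ℝ), pow_mul,
      Real.sq_sqrt hs]
  have h0 : Real.Gamma (β + 1) * a 0 = 1 := by
    simp [ha, hG.ne']
  have h1 : Real.Gamma (β + 1) * a 1 = -1 / (β + 1) := by
    have hGs : Real.Gamma (1 + β + 1) = (β + 1) * Real.Gamma (β + 1) := by
      rw [← Real.Gamma_add_one hβ'.ne']
      congr 1
      ring
    simp only [ha, Nat.factorial_one, Nat.cast_one, hGs]
    field_simp
  have hdiff : besselNorm β (2 * Real.sqrt s) - (1 - s / (β + 1))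
      = Real.Gamma (β + 1) * ∑' k, a (k + 2) * s ^ (k + 2) := by
    rw [hbessel, ← hterm.sum_add_tsum_nat_add 2, Finset.sum_range_succ, Finset.sum_range_one]
    linear_combination h0 + s * h1
  rw [hdiff, abs_mul, abs_of_pos hG, mul_assoc]
  exact mul_le_mul_of_nonneg_left hrest hG.le

/-- Near the origin, `|B_α(t) - 1| ≥ C |t|`. -/
theorem deformedHankelKernel_sub_one_lower_bound (α : ℝ) (hα : 1 / 4 < α) :
    ∃ C δ : ℝ, 0 < C ∧ 0 < δ ∧ ∀ t : ℝ, |t| ≤ δ →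
      C * |t| ≤ |deformedHankelKernel α t - 1| := by
  set b : ℝ := 2 * α with hb
  have hb0 : 0 < b := by linarith
  obtain ⟨K, hK, hj⟩ := exists_abs_besselNorm_sub_le (β := b - 1) (by linarith)
  obtain ⟨L, hL, hj'⟩ := exists_abs_besselNorm_sub_le (β := b + 1) (by linarith)
  set M : ℝ := K + 1 / (b * (b + 1)) * (1 / (b + 2) + L) with hM
  have hM0 : 0 ≤ M := by positivity
  refine ⟨1 / (2 * (b + 1)), min 1 (1 / (2 * (b + 1) * (M + 1))), by positivity,
    by positivity, fun t ht => ?_⟩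
  have ht1 : |t| ≤ 1 := ht.trans (min_le_left _ _)
  have ht2 : |t| ≤ 1 / (2 * (b + 1) * (M + 1)) := ht.trans (min_le_right _ _)
  have hs := abs_nonneg t
  have hGamma : Real.Gamma b / Real.Gamma (b + 2) = 1 / (b * (b + 1)) := by
    have hG := Real.Gamma_pos_of_pos hb0
    have : Real.Gamma (b + 2) = (b + 1) * (b * Real.Gamma b) := by
      rw [← Real.Gamma_add_one hb0.ne', ← Real.Gamma_add_one (by positivity)]
      congr 1
      ring
    rw [this]
    field_simp
  have e1 := hj |t| hs ht1
  have e2 := hj' |t| hs ht1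
  rw [sub_add_cancel] at e1
  rw [show b + 1 + 1 = b + 2 by ring] at e2
  simp only [deformedHankelKernel, ← hb, hGamma]
  set J := besselNorm (b - 1) (2 * Real.sqrt |t|)
  set J' := besselNorm (b + 1) (2 * Real.sqrt |t|)
  have e3 : |J' - 1| ≤ (1 / (b + 2) + L) * |t| := by
    have hsq : L * |t| ^ 2 ≤ L * |t| := by
      rw [sq]
      exact mul_le_mul_of_nonneg_left (mul_le_of_le_one_left hs ht1) hL
    have hdiv : |(|t| / (b + 2))| = 1 / (b + 2) * |t| := by
      rw [abs_of_nonneg (by positivity)]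
      ring
    calc |J' - 1| = |(J' - (1 - |t| / (b + 2))) - |t| / (b + 2)| := by ring_nf
      _ ≤ |J' - (1 - |t| / (b + 2))| + |(|t| / (b + 2))| := abs_sub _ _
      _ ≤ (1 / (b + 2) + L) * |t| := by linarith
  have e4 : |1 / (b * (b + 1)) * t * (J' - 1)|
      ≤ 1 / (b * (b + 1)) * (1 / (b + 2) + L) * |t| ^ 2 := by
    rw [abs_mul, abs_mul, abs_of_pos (show 0 < 1 / (b * (b + 1)) by positivity)]
    calc _ ≤ 1 / (b * (b + 1)) * |t| * ((1 / (b + 2) + L) * |t|) := by gcongr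
      _ = _ := by ring
  have hlin : 1 / (b + 1) * |t| ≤ |t| / b + 1 / (b * (b + 1)) * t := by
    have hsplit : |t| / b + 1 / (b * (b + 1)) * t - 1 / (b + 1) * |t|
        = 1 / (b * (b + 1)) * (|t| + t) := by
      field_simp
      ring
    have : 0 ≤ 1 / (b * (b + 1)) * (|t| + t) :=
      mul_nonneg (by positivity) (by linarith [neg_abs_le t])
    linarith
  have hquad : M * |t| ^ 2 ≤ 1 / (2 * (b + 1)) * |t| := by
    have : (M + 1) * |t| ≤ 1 / (2 * (b + 1)) := by
      calc (M + 1) * |t| ≤ (M + 1) * (1 / (2 * (b + 1) * (M + 1))) := by gcongr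
        _ = _ := by field_simp
    nlinarith
  have hhalf : 1 / (b + 1) = 1 / (2 * (b + 1)) + 1 / (2 * (b + 1)) := by
    field_simp
    norm_num
  rw [hhalf] at hlin
  rw [hM] at hquad
  rw [abs_le] at e1 e4
  refine le_trans ?_ (neg_le_abs _)
  linarith [e1.2, e4.1]
end

section
/- Let ω be a modulus of continuity on [0, δ0] satisfying the Zygmund condition (Z2). Then there exists a constant C > 0 such that for all s ∈ (0, δ0], ∫_s^{δ0} ω(u)²/u³ du ≤ C ω(s)²/s². -/
/-- The Zygmund condition (Z2) implies the corresponding quadratic estimate. -/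
theorem zygmund_sq (δ0 : ℝ) (hδ0 : 0 < δ0) (ω : ℝ → ℝ)
    (hω : IsModulusOfContinuity δ0 ω)
    (hZ2 : ∃ C : ℝ, 0 < C ∧ ∀ t : ℝ, 0 < t → t ≤ δ0 →
      (∫ x in t..δ0, ω x / x ^ 2) ≤ C * (ω t / t)) :
    ∃ C : ℝ, 0 < C ∧ ∀ s : ℝ, 0 < s → s ≤ δ0 →
      (∫ u in s..δ0, ω u ^ 2 / u ^ 3) ≤ C * (ω s ^ 2 / s ^ 2) := by
  obtain ⟨-, hcont, hnonneg, -, C₁, hC₁, hdec⟩ := hω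
  obtain ⟨C₂, hC₂, hZ⟩ := hZ2
  refine ⟨C₁ * C₂, by positivity, fun s hs hsδ => ?_⟩
  have hcont_s : ContinuousOn ω (Set.uIcc s δ0) := by
    rw [Set.uIcc_of_le hsδ]
    exact hcont.mono (Set.Icc_subset_Icc_left hs.le)
  have hpos : ∀ u ∈ Set.uIcc s δ0, 0 < u := fun u hu => by
    rw [Set.uIcc_of_le hsδ] at hu
    exact hs.trans_le hu.1
  have hint_sq : IntervalIntegrable (fun u => ω u ^ 2 / u ^ 3) MeasureTheory.volume s δ0 :=
    ((hcont_s.pow 2).div (by fun_prop) fun u hu =>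
      (pow_pos (hpos u hu) 3).ne').intervalIntegrable
  have hint : IntervalIntegrable (fun u => ω u / u ^ 2) MeasureTheory.volume s δ0 :=
    (hcont_s.div (by fun_prop) fun u hu => (pow_pos (hpos u hu) 2).ne').intervalIntegrable
  have hωs : 0 ≤ ω s := hnonneg s ⟨hs.le, hsδ⟩
  calc (∫ u in s..δ0, ω u ^ 2 / u ^ 3)
      ≤ ∫ u in s..δ0, C₁ * (ω s / s) * (ω u / u ^ 2) := by
        refine intervalIntegral.integral_mono_on hsδ hint_sq (hint.const_mul _) fun u hu => ?_
        have hu0 : 0 < u := hs.trans_le hu.1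
        have hωu : 0 ≤ ω u := hnonneg u ⟨hu0.le, hu.2⟩
        calc ω u ^ 2 / u ^ 3 = ω u / u * (ω u / u ^ 2) := by field_simp
          _ ≤ C₁ * (ω s / s) * (ω u / u ^ 2) :=
            mul_le_mul_of_nonneg_right (hdec s u hs hu.1 hu.2) (by positivity)
    _ = C₁ * (ω s / s) * ∫ u in s..δ0, ω u / u ^ 2 := intervalIntegral.integral_const_mul _ _
    _ ≤ C₁ * (ω s / s) * (C₂ * (ω s / s)) :=
        mul_le_mul_of_nonneg_left (hZ s hs hsδ) (by positivity)
    _ = C₁ * C₂ * (ω s ^ 2 / s ^ 2) := by ring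
end
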